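/- Let q be a power of a prime and F_q the finite field with q elements. Let A, B ⊆ F_q with 2 ≤ |B| ≤ |A|, and suppose there is a constant C > 0 such that for every proper subfield G of F_q and all elements c, d ∈ F_q one has |A ∩ (cG + d)| ≤ C·max{|G|^{1/2}, |A|^{31/191}|B|^{129/191}}. Then there is a constant C' > 0 depending only on C such that T(A, B) ≤ C'·(|A|^{383/191}|B|^{571/191} + q^{-1/103}|A|^{207/103}|B|^{3} + |A|^{3}|B|). -/

import Mathlib

open scoped Classical Pointwise

noncomputable section

namespace STP

variable {F : Type} [Field F]

def collinearTriples (A B : Finset F) : ℕ :=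
  (((A ×ˢ A ×ˢ A) ×ˢ (B ×ˢ B ×ˢ B)).filter fun x =>
    (x.1.2.1 - x.1.1) * (x.2.2.2 - x.2.1) = (x.1.2.2 - x.1.1) * (x.2.2.1 - x.2.1)).card

def IsLine (l : Set (F × F)) : Prop :=
  ∃ a b c : F, (a, b) ≠ (0, 0) ∧ l = {p : F × F | a * p.1 + b * p.2 = c}

def incidences (P : Finset (F × F)) (L : Finset (Set (F × F))) : ℕ :=
  ((P ×ˢ L).filter fun x => x.1 ∈ x.2).card

def kIncidences (P : Finset (F × F)) (L : Finset (Set (F × F))) (k : ℕ) : ℕ :=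
  (((Fintype.piFinset fun _ : Fin k => P) ×ˢ L).filter fun x => ∀ i, x.1 i ∈ x.2).card

def numLines (P : Finset (F × F)) : ℕ :=
  Set.ncard {l : Set (F × F) | IsLine l ∧ 2 ≤ (P.filter (· ∈ l)).card}

def addEnergy (X Y : Finset F) : ℕ :=
  (((X ×ˢ X) ×ˢ (Y ×ˢ Y)).filter fun t => t.1.1 + t.2.1 = t.1.2 + t.2.2).card

def mulEnergy (A : Finset F) : ℕ :=
  (((A ×ˢ A) ×ˢ (A ×ˢ A)).filter fun t => t.1.1 * t.2.1 = t.1.2 * t.2.2).card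

def quotSet (X : Finset F) : Set F :=
  {r : F | ∃ x1 ∈ X, ∃ x2 ∈ X, ∃ x3 ∈ X, ∃ x4 ∈ X, x3 ≠ x4 ∧ r = (x1 - x2) / (x3 - x4)}

def subfieldCond (A : Finset F) (C bound : ℝ) : Prop :=
  ∀ G : Subfield F, G ≠ ⊤ → ∀ c d : F,
    ((A.filter fun x => ∃ g ∈ G, x = c * g + d).card : ℝ) ≤
      C * max ((Nat.card G : ℝ) ^ ((1:ℝ)/2)) bound

def linesOf [Fintype F] (P : Finset (F × F)) : Finset (Set (F × F)) :=
  Set.Finite.toFinset (Set.toFinite {l : Set (F × F) | IsLine l ∧ 2 ≤ (P.filter (· ∈ l)).card})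

def tripleCount [Fintype F] (P : Finset (F × F)) : ℕ :=
  ∑ l ∈ linesOf P, ((P.filter (· ∈ l)).card) ^ 3


lemma card_filter_sum {α β : Type*} (A : Finset α) (B : Finset β) (E : α → β → Prop)
    [∀ a b, Decidable (E a b)] :
    ∑ a ∈ A, ((B.filter (fun b => E a b)).card : ℝ) =
      ∑ b ∈ B, ((A.filter (fun a => E a b)).card : ℝ) := by
  have := Finset.sum_card_bipartiteAbove_eq_sum_card_bipartiteBelow (s := A) (t := B) E
  simp only [Finset.bipartiteAbove, Finset.bipartiteBelow] at this
  exact_mod_cast this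

/-- popularity pruning: the elements with large value carry half of the mass -/
lemma popular_sum {α : Type*} (A : Finset α) (f : α → ℝ) (t : ℝ) (ht : 0 ≤ t) :
    ∑ a ∈ A, f a ≤ ∑ a ∈ A.filter (fun a => t ≤ f a), f a + A.card * t := by
  rw [← Finset.sum_filter_add_sum_filter_not A (fun a => t ≤ f a)]
  gcongr
  calc ∑ a ∈ A.filter (fun a => ¬ t ≤ f a), f a
      ≤ ∑ a ∈ A.filter (fun a => ¬ t ≤ f a), t := by
        apply Finset.sum_le_sum
        intro a ha
        simp only [Finset.mem_filter, not_le] at ha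
        exact ha.2.le
    _ = (A.filter (fun a => ¬ t ≤ f a)).card * t := by simp
    _ ≤ A.card * t := by
        gcongr
        exact Finset.filter_subset _ _

lemma bsg_graph {α β : Type*} (A : Finset α) (B : Finset β) (E : α → β → Prop) (N K : ℝ)
    (hN : 0 < N) (hK : 0 < K) (hA : (A.card : ℝ) = N) (hB : (B.card : ℝ) = N)
    (hE : N ^ 2 / K ≤ ∑ a ∈ A, ((B.filter (fun b => E a b)).card : ℝ)) :
    ∃ A' ⊆ A, ∃ B' ⊆ B, N / (6 * K) ≤ A'.card ∧ N / (6 * K) ≤ B'.card ∧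
      ∀ a ∈ A', ∀ b ∈ B', N ^ 2 / (3072 * K ^ 5) ≤
        (((B ×ˢ A).filter (fun p => E a p.1 ∧ E p.2 p.1 ∧ E p.2 b)).card : ℝ) := by
  set A1 := A.filter (fun a => N / (2 * K) ≤ ((B.filter (fun b => E a b)).card : ℝ)) with hA1
  have h1 : N ^ 2 / (2 * K) ≤ ∑ a ∈ A1, ((B.filter (fun b => E a b)).card : ℝ) := by
    have := popular_sum A (fun a => ((B.filter (fun b => E a b)).card : ℝ)) (N / (2 * K))
      (by positivity)
    rw [hA] at this
    have e : N ^ 2 / K = N ^ 2 / (2 * K) + N * (N / (2 * K)) := by field_simp; ring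
    simp only [← hA1] at this
    linarith
  have hA1c : (A1.card : ℝ) ≤ N := by
    rw [← hA]; exact_mod_cast Finset.card_le_card (Finset.filter_subset _ _)
  set n : β → Finset α := fun v => A1.filter (fun a => E a v) with hn
  have h2 : N ^ 3 / (4 * K ^ 2) ≤ ∑ v ∈ B, ((n v).card : ℝ) ^ 2 := by
    have c := sq_sum_le_card_mul_sum_sq (s := B) (f := fun v => ((n v).card : ℝ))
    rw [hB, ← card_filter_sum] at c
    have : (N ^ 2 / (2 * K)) ^ 2 ≤ N * ∑ v ∈ B, ((n v).card : ℝ) ^ 2 :=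
      le_trans (by gcongr) c
    have e : (N ^ 2 / (2 * K)) ^ 2 = N * (N ^ 3 / (4 * K ^ 2)) := by field_simp; ring
    rw [e] at this
    exact le_of_mul_le_mul_left this hN
  set cod : α → α → ℝ := fun a a' => ((B.filter (fun v => E a v ∧ E a' v)).card : ℝ) with hcod
  set Bad : α × α → Prop := fun p => cod p.1 p.2 < N / (128 * K ^ 3) with hBad
  have h3 : ∑ v ∈ B, (((n v ×ˢ n v).filter Bad).card : ℝ) ≤ N ^ 2 * (N / (128 * K ^ 3)) := by
    have e1 : ∀ v, (n v ×ˢ n v).filter Bad =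
        ((A1 ×ˢ A1).filter Bad).filter (fun p => E p.1 v ∧ E p.2 v) := by
      intro v; ext p
      simp only [hn, Finset.mem_filter, Finset.mem_product]; tauto
    simp_rw [e1]
    rw [← card_filter_sum ((A1 ×ˢ A1).filter Bad) B (fun p v => E p.1 v ∧ E p.2 v)]
    calc _ ≤ ∑ p ∈ (A1 ×ˢ A1).filter Bad, N / (128 * K ^ 3) := by
          apply Finset.sum_le_sum
          intro p hp
          exact (Finset.mem_filter.1 hp).2.le
      _ = ((A1 ×ˢ A1).filter Bad).card * (N / (128 * K ^ 3)) := by simp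
      _ ≤ N ^ 2 * (N / (128 * K ^ 3)) := by
          gcongr
          calc (((A1 ×ˢ A1).filter Bad).card : ℝ) ≤ ((A1 ×ˢ A1).card : ℝ) := by
                exact_mod_cast Finset.card_le_card (Finset.filter_subset _ _)
            _ = (A1.card : ℝ) ^ 2 := by rw [Finset.card_product]; push_cast; ring
            _ ≤ N ^ 2 := by gcongr
  have hBne : B.Nonempty := by
    rw [← Finset.card_pos]
    have : (0 : ℝ) < B.card := by rw [hB]; exact hN
    exact_mod_cast this
  obtain ⟨v, hvB, hv⟩ : ∃ v ∈ B, N ^ 2 / (8 * K ^ 2) + 16 * K * (((n v ×ˢ n v).filter Bad).card : ℝ)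
      ≤ ((n v).card : ℝ) ^ 2 := by
    apply Finset.exists_le_of_sum_le hBne
    refine le_trans ?_ h2
    rw [Finset.sum_add_distrib, ← Finset.mul_sum, Finset.sum_const, nsmul_eq_mul, hB]
    calc N * (N ^ 2 / (8 * K ^ 2)) + 16 * K * ∑ i ∈ B, (((n i ×ˢ n i).filter Bad).card : ℝ)
        ≤ N * (N ^ 2 / (8 * K ^ 2)) + 16 * K * (N ^ 2 * (N / (128 * K ^ 3))) := by gcongr
      _ = N ^ 3 / (4 * K ^ 2) := by field_simp; ring
  set A' := n v with hA'
  set M : ℝ := (A'.card : ℝ) with hM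
  have hM0 : 0 ≤ M := by positivity
  have hMbig : N / (3 * K) ≤ M := by
    apply le_of_sq_le_sq _ hM0 |> fun h => h
    have : 0 ≤ 16 * K * (((A' ×ˢ A').filter Bad).card : ℝ) := by positivity
    have e : (N / (3 * K)) ^ 2 ≤ N ^ 2 / (8 * K ^ 2) := by
      rw [div_pow, mul_pow]
      gcongr; norm_num
    linarith
  have hMpos : 0 < M := lt_of_lt_of_le (by positivity) hMbig
  have hbad : (((A' ×ˢ A').filter Bad).card : ℝ) ≤ M ^ 2 / (16 * K) := by
    rw [le_div_iff₀ (by positivity)]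
    have : 0 ≤ N ^ 2 / (8 * K ^ 2) := by positivity
    linarith
  set A2 := A'.filter (fun a => ((A'.filter (fun a' => Bad (a, a'))).card : ℝ) ≤ M / (8 * K)) with hA2
  set B' := B.filter (fun b => M / (4 * K) ≤ ((A'.filter (fun a => E a b)).card : ℝ)) with hB'
  have hA'A1 : A' ⊆ A1 := Finset.filter_subset _ _
  refine ⟨A2, (Finset.filter_subset _ _).trans (hA'A1.trans (Finset.filter_subset _ _)),
    B', Finset.filter_subset _ _, ?_, ?_, ?_⟩
  · skip
    have s1 : ∑ a ∈ A', ((A'.filter (fun a' => Bad (a, a'))).card : ℝ) ≤ M ^ 2 / (16 * K) := by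
      refine le_trans (le_of_eq ?_) hbad
      rw [Finset.card_filter, Finset.sum_product]
      push_cast
      apply Finset.sum_congr rfl
      intro a _
      rw [Finset.card_filter]; push_cast; rfl
    have s2 : (A'.filter (fun a => ¬ ((A'.filter (fun a' => Bad (a, a'))).card : ℝ) ≤ M / (8 * K))).card
        * (M / (8 * K)) ≤ M ^ 2 / (16 * K) := by
      refine le_trans ?_ s1
      rw [← nsmul_eq_mul, ← Finset.sum_const]
      refine le_trans (Finset.sum_le_sum (g := fun a => ((A'.filter (fun a' => Bad (a, a'))).card : ℝ)) ?_) ?_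
      · intro a ha
        exact (not_le.1 (Finset.mem_filter.1 ha).2).le
      · apply Finset.sum_le_sum_of_subset_of_nonneg (Finset.filter_subset _ _)
        intros; positivity
    have s3 := Finset.card_filter_add_card_filter_not (s := A')
      (fun a => ((A'.filter (fun a' => Bad (a, a'))).card : ℝ) ≤ M / (8 * K))
    rw [← hA2] at s3
    have s3' : (A2.card : ℝ) + ((A'.filter (fun a => ¬ ((A'.filter (fun a' => Bad (a, a'))).card : ℝ) ≤ M / (8 * K))).card : ℝ) = M := by
      rw [hM]; exact_mod_cast s3
    have s4 : ((A'.filter (fun a => ¬ ((A'.filter (fun a' => Bad (a, a'))).card : ℝ) ≤ M / (8 * K))).card : ℝ) ≤ M / 2 := by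
      have e : M ^ 2 / (16 * K) = M / 2 * (M / (8 * K)) := by field_simp; ring
      rw [e] at s2
      exact le_of_mul_le_mul_right s2 (by positivity)
    have e : N / (6 * K) = N / (3 * K) / 2 := by field_simp; ring
    rw [e]; linarith
  · skip
    have s1 : M * (N / (2 * K)) ≤ ∑ b ∈ B, ((A'.filter (fun a => E a b)).card : ℝ) := by
      rw [← card_filter_sum, hM, ← nsmul_eq_mul, ← Finset.sum_const]
      apply Finset.sum_le_sum
      intro a ha
      exact (Finset.mem_filter.1 (hA'A1 ha)).2
    have s2 := popular_sum B (fun b => ((A'.filter (fun a => E a b)).card : ℝ)) (M / (4 * K)) (by positivity)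
    rw [hB] at s2
    simp only [← hB'] at s2
    have s3 : ∑ b ∈ B', ((A'.filter (fun a => E a b)).card : ℝ) ≤ B'.card * M := by
      rw [← nsmul_eq_mul, ← Finset.sum_const]
      apply Finset.sum_le_sum
      intro b _
      rw [hM]
      exact_mod_cast Finset.card_le_card (Finset.filter_subset _ _)
    have e : M * (N / (2 * K)) = N / (4 * K) * M + N * (M / (4 * K)) := by field_simp; ring
    have s4 : N / (4 * K) * M ≤ B'.card * M := by linarith
    have s5 := le_of_mul_le_mul_right s4 hMpos
    refine le_trans ?_ s5
    gcongr; norm_num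
  · intro a ha b hb
    have hb' := (Finset.mem_filter.1 hb).2
    have ha' := (Finset.mem_filter.1 ha).2
    set Gd := (A'.filter (fun a => E a b)) \ (A'.filter (fun a' => Bad (a, a'))) with hGd
    have g1 : M / (8 * K) ≤ (Gd.card : ℝ) := by
      have : ((A'.filter (fun a => E a b)).card : ℝ) ≤ Gd.card + ((A'.filter (fun a' => Bad (a, a'))).card : ℝ) := by
        exact_mod_cast Finset.card_le_card_sdiff_add_card
      have e : M / (4 * K) = M / (8 * K) + M / (8 * K) := by field_simp; ring
      linarith
    have g2 : ∑ a' ∈ Gd, cod a a' ≤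
        (((B ×ˢ A).filter (fun p => E a p.1 ∧ E p.2 p.1 ∧ E p.2 b)).card : ℝ) := by
      rw [Finset.card_filter, Finset.sum_product_right]
      push_cast
      have hsub : Gd ⊆ A := (Finset.sdiff_subset.trans (Finset.filter_subset _ _)).trans
        (hA'A1.trans (Finset.filter_subset _ _))
      refine le_trans ?_ (Finset.sum_le_sum_of_subset_of_nonneg hsub ?_)
      · apply Finset.sum_le_sum
        intro a' ha2
        have hE2 : E a' b := by
          have := (Finset.mem_sdiff.1 ha2).1
          exact (Finset.mem_filter.1 this).2
        simp only [hcod, Finset.card_filter, hE2, and_true]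
        push_cast
        rfl
      · intros; positivity
    refine le_trans ?_ g2
    calc N ^ 2 / (3072 * K ^ 5) = (N / (3 * K)) / (8 * K) * (N / (128 * K ^ 3)) := by
          field_simp; norm_num
      _ ≤ M / (8 * K) * (N / (128 * K ^ 3)) := by gcongr
      _ ≤ Gd.card * (N / (128 * K ^ 3)) := by gcongr
      _ = ∑ a' ∈ Gd, N / (128 * K ^ 3) := by simp
      _ ≤ _ := by
          apply Finset.sum_le_sum
          intro a' ha2
          have h := Finset.mem_sdiff.1 ha2
          by_contra hlt
          apply h.2
          rw [Finset.mem_filter]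
          exact ⟨(Finset.mem_filter.1 h.1).1, not_le.1 hlt⟩

lemma fiber_sum_le {α β : Type*} (S : Finset α) (Z : Finset β) (f : α → β) :
    ∑ z ∈ Z, ((S.filter (fun t => f t = z)).card : ℝ) ≤ S.card := by
  rw [← card_filter_sum S Z (fun t z => f t = z), Finset.cast_card]
  apply Finset.sum_le_sum
  intro t _
  have : (Z.filter (fun z => f t = z)).card ≤ 1 := by
    rw [Finset.card_le_one]
    intro x hx y hy
    rw [← (Finset.mem_filter.1 hx).2, ← (Finset.mem_filter.1 hy).2]
  exact_mod_cast this

/-- Balog, Szemeredi and Gowers for differences with a dilate. -/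
lemma bsg_diff (A S : Finset F) (b : F) (hb : b ≠ 0) (N K : ℝ)
    (hN : 0 < N) (hK : 0 < K) (hA : (A.card : ℝ) = N) (hS : (S.card : ℝ) ≤ N)
    (hE : N ^ 2 / K ≤ ∑ a ∈ A, ((A.filter (fun c => a - b * c ∈ S)).card : ℝ)) :
    ∃ A' ⊆ A, ∃ B' ⊆ A, N / (6 * K) ≤ A'.card ∧ N / (6 * K) ≤ B'.card ∧
      ((A' - b • B').card : ℝ) ≤ 3072 * K ^ 5 * N := by
  obtain ⟨A', hA', B', hB', h1, h2, h3⟩ :=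
    bsg_graph A A (fun a c => a - b * c ∈ S) N K hN hK hA hA (by convert hE)
  refine ⟨A', hA', B', hB', h1, h2, ?_⟩
  set Z := A' - b • B' with hZ
  have key : ∀ z ∈ Z, N ^ 2 / (3072 * K ^ 5) ≤
      (((S ×ˢ S ×ˢ S).filter (fun t => t.1 - t.2.1 + t.2.2 = z)).card : ℝ) := by
    intro z hz
    rw [hZ, Finset.mem_sub] at hz
    obtain ⟨a, ha, y, hy, rfl⟩ := hz
    rw [Finset.mem_smul_finset] at hy
    obtain ⟨c, hc, rfl⟩ := hy
    refine le_trans (h3 a ha c hc) ?_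
    norm_cast
    apply Finset.card_le_card_of_injOn
      (fun p => (a - b * p.1, p.2 - b * p.1, p.2 - b * c))
    · intro p hp
      simp only [Finset.coe_filter, Finset.mem_product, Set.mem_ofPred_eq, smul_eq_mul] at hp ⊢
      refine ⟨⟨hp.2.1, hp.2.2.1, hp.2.2.2⟩, by ring⟩
    · intro p _ p' _ h
      simp only [Prod.mk.injEq] at h
      obtain ⟨e1, e2, e3⟩ := h
      have f2 : p.2 = p'.2 := by simpa using e3
      have f1 : p.1 = p'.1 := by
        have : b * p.1 = b * p'.1 := by simpa using e1
        exact mul_left_cancel₀ hb this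
      exact Prod.ext f1 f2
  have hs := fiber_sum_le (S ×ˢ S ×ˢ S) Z (fun t => t.1 - t.2.1 + t.2.2)
  have hs2 : (Z.card : ℝ) * (N ^ 2 / (3072 * K ^ 5)) ≤ N ^ 3 := by
    calc (Z.card : ℝ) * (N ^ 2 / (3072 * K ^ 5)) = ∑ z ∈ Z, N ^ 2 / (3072 * K ^ 5) := by simp
      _ ≤ _ := Finset.sum_le_sum key
      _ ≤ _ := hs
      _ = (S.card : ℝ) ^ 3 := by simp only [Finset.card_product]; push_cast; ring
      _ ≤ N ^ 3 := by gcongr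
  have e : N ^ 3 = 3072 * K ^ 5 * N * (N ^ 2 / (3072 * K ^ 5)) := by field_simp
  rw [e] at hs2
  exact le_of_mul_le_mul_right hs2 (by positivity)

lemma coll_ge {α β : Type*} (s : Finset α) (Z : Finset β) (f : α → β) (hf : ∀ x ∈ s, f x ∈ Z) :
    (s.card : ℝ) ^ 2 ≤ Z.card * (((s ×ˢ s).filter (fun p => f p.1 = f p.2)).card : ℝ) := by
  have h1 : (s.card : ℝ) = ∑ z ∈ Z, ((s.filter (fun x => f x = z)).card : ℝ) := by
    exact_mod_cast Finset.card_eq_sum_card_fiberwise (f := f) (s := s) (t := Z) hf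
  have h2 : (((s ×ˢ s).filter (fun p => f p.1 = f p.2)).card : ℝ) =
      ∑ z ∈ Z, ((s.filter (fun x => f x = z)).card : ℝ) ^ 2 := by
    have := Finset.card_eq_sum_card_fiberwise (f := fun p : α × α => f p.1)
      (s := (s ×ˢ s).filter (fun p => f p.1 = f p.2)) (t := Z) (by
        intro p hp
        simp only [Finset.coe_filter, Finset.mem_product, Set.mem_ofPred_eq] at hp
        exact hf _ hp.1.1)
    rw [this]
    push_cast
    apply Finset.sum_congr rfl
    intro z _
    rw [pow_two, ← Nat.cast_mul, ← Finset.card_product]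
    congr 2
    ext p
    simp only [Finset.mem_filter, Finset.mem_product]
    constructor
    · rintro ⟨⟨⟨a, b⟩, c⟩, d⟩
      exact ⟨⟨a, d⟩, b, by rw [← c, d]⟩
    · rintro ⟨⟨a, d⟩, b, c⟩
      exact ⟨⟨⟨a, b⟩, by rw [d, c]⟩, d⟩
  rw [h2, h1]
  exact sq_sum_le_card_mul_sum_sq

lemma surj_of_maps {F : Type} [Fintype F] (R : Set F) (f : F → F) (hf : Function.Injective f)
    (h : ∀ r ∈ R, f r ∈ R) : ∀ r ∈ R, ∃ r' ∈ R, f r' = r := by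
  have h1 : f '' R ⊆ R := by
    rintro _ ⟨r, hr, rfl⟩; exact h r hr
  have h2 : f '' R = R := by
    apply Set.eq_of_subset_of_ncard_le h1
    rw [Set.ncard_image_of_injective _ hf]
  intro r hr
  rw [← h2] at hr
  exact hr

lemma closure_sub {F : Type} [Field F] [Fintype F] (Y : Finset F) (R : Set F) (h0 : (0 : F) ∈ R)
    (h1 : ∀ r ∈ R, 1 + r ∈ R) (hy : ∀ y ∈ Y, y ≠ 0 → ∀ r ∈ R, y * r ∈ R) :
    ∃ G : Subfield F, (∀ y ∈ Y, y ∈ G) ∧ ∀ g ∈ G, g ∈ R := by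
  have hneg : ∀ s : F, (∀ r ∈ R, s + r ∈ R) → ∀ r ∈ R, -s + r ∈ R := by
    intro s hs r hr
    obtain ⟨r', hr', e⟩ := surj_of_maps R (fun x => s + x) (add_right_injective s) hs r hr
    have : -s + r = r' := by rw [← e]; ring
    rw [this]; exact hr'
  let H : AddSubgroup F :=
    { carrier := {s | ∀ r ∈ R, s + r ∈ R}
      zero_mem' := by intro r hr; simpa using hr
      add_mem' := by
        intro a b ha hb r hr
        rw [add_assoc]; exact ha _ (hb _ hr)
      neg_mem' := by
        intro a ha; exact hneg a ha }
  let M : Subring F :=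
    { carrier := {m | ∀ s ∈ H, m * s ∈ H}
      zero_mem' := by intro s _; rw [zero_mul]; exact H.zero_mem
      one_mem' := by intro s hs; rw [one_mul]; exact hs
      add_mem' := by
        intro a b ha hb s hs
        rw [add_mul]; exact H.add_mem (ha s hs) (hb s hs)
      mul_mem' := by
        intro a b ha hb s hs
        rw [mul_assoc]; exact ha _ (hb _ hs)
      neg_mem' := by
        intro a ha s hs
        rw [neg_mul]; exact H.neg_mem (ha s hs) }
  let G : Subfield F := Subfield.mk M (by
    intro x hx
    by_cases hx0 : x = 0
    · rw [hx0, inv_zero]; exact M.zero_mem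
    · have hq : 1 < Fintype.card F := Fintype.one_lt_card
      have e : x⁻¹ = x ^ (Fintype.card F - 2) := by
        have := FiniteField.pow_card_sub_one_eq_one x hx0
        have e2 : Fintype.card F - 1 = (Fintype.card F - 2) + 1 := by omega
        rw [e2, pow_succ] at this
        exact (eq_inv_of_mul_eq_one_left this).symm
      rw [e]
      exact M.pow_mem hx _)
  refine ⟨G, ?_, ?_⟩
  · intro y hyY
    change ∀ s ∈ H, y * s ∈ H
    intro s hs
    by_cases hy0 : y = 0
    · rw [hy0, zero_mul]; exact H.zero_mem
    · intro r hr
      obtain ⟨r', hr', e⟩ := surj_of_maps R (fun x => y * x) (mul_right_injective₀ hy0)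
        (hy y hyY hy0) r hr
      have : y * s + r = y * (s + r') := by rw [← e]; ring
      rw [this]
      exact hy y hyY hy0 _ (hs r' hr')
  · intro g hg
    have : g * 1 ∈ H := hg 1 h1
    have h := this 0 h0
    simpa using h

lemma plun (A0 D : Finset F) (L : ℝ) (hA0 : A0.Nonempty)
    (hD : ∀ d ∈ D, ((A0 - d • A0).card : ℝ) ≤ L * A0.card) (m n : ℕ) :
    (((m • (D.biUnion fun d => -(d • A0)) - n • (D.biUnion fun d => -(d • A0))).card : ℝ)) ≤
      (D.card * L) ^ (m + n) * A0.card := by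
  set B := D.biUnion fun d => -(d • A0) with hB
  have h := Finset.pluennecke_ruzsa_inequality_nsmul_sub_nsmul_add hA0 B m n
  have h' : ((m • B - n • B).card : ℝ) ≤ ((A0 + B).card / A0.card : ℝ) ^ (m + n) * A0.card := by
    have h3 : (((m • B - n • B).card : ℚ≥0) : ℝ) ≤
      ((((A0 + B).card / A0.card : ℚ≥0) ^ (m + n) * A0.card : ℚ≥0) : ℝ) := by exact_mod_cast h
    push_cast at h3
    exact h3
  refine h'.trans ?_
  have hpos : (0 : ℝ) < A0.card := by exact_mod_cast hA0.card_pos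
  have h2 : ((A0 + B).card : ℝ) ≤ D.card * L * A0.card := by
    have e : A0 + B ⊆ D.biUnion fun d => A0 - d • A0 := by
      intro x hx
      obtain ⟨a, ha, b, hb, rfl⟩ := Finset.mem_add.1 hx
      obtain ⟨d, hd, hb⟩ := Finset.mem_biUnion.1 hb
      refine Finset.mem_biUnion.2 ⟨d, hd, ?_⟩
      rw [sub_eq_add_neg]
      exact Finset.add_mem_add ha hb
    calc ((A0 + B).card : ℝ) ≤ ∑ d ∈ D, ((A0 - d • A0).card : ℝ) := by
          exact_mod_cast (Finset.card_le_card e).trans Finset.card_biUnion_le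
      _ ≤ ∑ d ∈ D, L * A0.card := Finset.sum_le_sum hD
      _ = D.card * L * A0.card := by simp; ring
  gcongr
  rw [div_le_iff₀ hpos]
  exact h2

lemma mem_plun (A0 D : Finset F) (d a : F) (hd : d ∈ D) (ha : a ∈ A0) :
    -(d * a) ∈ (D.biUnion fun d => -(d • A0)) := by
  refine Finset.mem_biUnion.2 ⟨d, hd, ?_⟩
  apply Finset.neg_mem_neg
  exact Finset.mem_smul_finset.2 ⟨a, ha, rfl⟩

lemma card_le_smul (A0 : Finset F) (r g : F) (hg : g ≠ 0) (Z : Finset F)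
    (h : ∀ a ∈ A0, ∀ a' ∈ A0, g * (a + r * a') ∈ Z) : (A0 + r • A0).card ≤ Z.card := by
  rw [← Finset.card_smul_finset₀ hg (A0 + r • A0)]
  apply Finset.card_le_card
  intro x hx
  obtain ⟨y, hy, rfl⟩ := Finset.mem_smul_finset.1 hx
  obtain ⟨a, ha, z, hz, rfl⟩ := Finset.mem_add.1 hy
  obtain ⟨a', ha', rfl⟩ := Finset.mem_smul_finset.1 hz
  exact h a ha a' ha'

lemma two_nsmul_mem {B : Finset F} {x y : F} (hx : x ∈ B) (hy : y ∈ B) : x + y ∈ 2 • B := by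
  rw [two_nsmul]; exact Finset.add_mem_add hx hy

lemma three_nsmul_mem {B : Finset F} {x y z : F} (hx : x ∈ B) (hy : y ∈ B) (hz : z ∈ B) :
    x + y + z ∈ 3 • B := by
  rw [succ_nsmul]; exact Finset.add_mem_add (two_nsmul_mem hx hy) hz

lemma quot_bound1 (A0 Y : Finset F) (L : ℝ) (hL : 0 ≤ L) (hA0 : A0.Nonempty)
    (hY : ∀ d ∈ Y, ((A0 - d • A0).card : ℝ) ≤ L * A0.card) (r : F) (hr : r ∈ quotSet Y) :
    ((A0 + r • A0).card : ℝ) ≤ (4 * L) ^ 4 * A0.card ∧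
    ((A0 + (1 + r) • A0).card : ℝ) ≤ (4 * L) ^ 6 * A0.card := by
  obtain ⟨x1, h1, x2, h2, x3, h3, x4, h4, hne, rfl⟩ := hr
  have hg : x3 - x4 ≠ 0 := sub_ne_zero.2 hne
  set D : Finset F := {x1, x2, x3, x4} with hD
  have hDY : ∀ d ∈ D, ((A0 - d • A0).card : ℝ) ≤ L * A0.card := by
    intro d hd
    apply hY
    simp only [hD, Finset.mem_insert, Finset.mem_singleton] at hd
    rcases hd with rfl | rfl | rfl | rfl <;> assumption
  have hDc : (D.card : ℝ) ≤ 4 := by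
    exact_mod_cast Finset.card_le_four
  have m1 : x1 ∈ D := by simp [hD]
  have m2 : x2 ∈ D := by simp [hD]
  have m3 : x3 ∈ D := by simp [hD]
  have m4 : x4 ∈ D := by simp [hD]
  constructor
  · calc ((A0 + ((x1 - x2) / (x3 - x4)) • A0).card : ℝ) ≤
        (((2 • (D.biUnion fun d => -(d • A0)) - 2 • (D.biUnion fun d => -(d • A0))).card : ℝ)) := by
          norm_cast
          apply card_le_smul _ _ (x3 - x4) hg
          intro a ha a' ha'
          have e : (x3 - x4) * (a + (x1 - x2) / (x3 - x4) * a') =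
            (-(x4 * a) + -(x2 * a')) - (-(x3 * a) + -(x1 * a')) := by field_simp; ring
          rw [e]
          apply Finset.sub_mem_sub <;> apply two_nsmul_mem <;> apply mem_plun <;> assumption
      _ ≤ (D.card * L) ^ (2 + 2) * A0.card := plun A0 D L hA0 hDY 2 2
      _ ≤ (4 * L) ^ 4 * A0.card := by gcongr
  · calc ((A0 + (1 + (x1 - x2) / (x3 - x4)) • A0).card : ℝ) ≤
        (((3 • (D.biUnion fun d => -(d • A0)) - 3 • (D.biUnion fun d => -(d • A0))).card : ℝ)) := by
          norm_cast
          apply card_le_smul _ _ (x3 - x4) hg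
          intro a ha a' ha'
          have e : (x3 - x4) * (a + (1 + (x1 - x2) / (x3 - x4)) * a') =
            (-(x4 * a) + -(x4 * a') + -(x2 * a')) - (-(x3 * a) + -(x3 * a') + -(x1 * a')) := by
              field_simp; ring
          rw [e]
          apply Finset.sub_mem_sub <;> apply three_nsmul_mem <;> apply mem_plun <;> assumption
      _ ≤ (D.card * L) ^ (3 + 3) * A0.card := plun A0 D L hA0 hDY 3 3
      _ ≤ (4 * L) ^ 6 * A0.card := by gcongr

lemma three_bound (A0 : Finset F) (L : ℝ) (hL : 0 ≤ L) (hA0 : A0.Nonempty) (x y z : F)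
    (hx : ((A0 - x • A0).card : ℝ) ≤ L * A0.card) (hy : ((A0 - y • A0).card : ℝ) ≤ L * A0.card)
    (hz : ((A0 - z • A0).card : ℝ) ≤ L * A0.card) :
    (((x • A0 - y • A0) - z • A0).card : ℝ) ≤ (4 * L) ^ 3 * A0.card := by
  set D : Finset F := {x, y, z} with hD
  have hDY : ∀ d ∈ D, ((A0 - d • A0).card : ℝ) ≤ L * A0.card := by
    intro d hd
    simp only [hD, Finset.mem_insert, Finset.mem_singleton] at hd
    rcases hd with rfl | rfl | rfl <;> assumption
  have hDc : (D.card : ℝ) ≤ 4 := by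
    have : D.card ≤ 3 := Finset.card_le_three
    exact_mod_cast this.trans (by norm_num)
  have m1 : x ∈ D := by simp [hD]
  have m2 : y ∈ D := by simp [hD]
  have m3 : z ∈ D := by simp [hD]
  calc (((x • A0 - y • A0) - z • A0).card : ℝ) ≤
      (((2 • (D.biUnion fun d => -(d • A0)) - 1 • (D.biUnion fun d => -(d • A0))).card : ℝ)) := by
        norm_cast
        apply Finset.card_le_card
        intro w hw
        obtain ⟨u, hu, v, hv, rfl⟩ := Finset.mem_sub.1 hw
        obtain ⟨s, hs, t, ht, rfl⟩ := Finset.mem_sub.1 hu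
        obtain ⟨a, ha, rfl⟩ := Finset.mem_smul_finset.1 hs
        obtain ⟨a', ha', rfl⟩ := Finset.mem_smul_finset.1 ht
        obtain ⟨a'', ha'', rfl⟩ := Finset.mem_smul_finset.1 hv
        have e : x • a - y • a' - z • a'' = (-(y * a') + -(z * a'')) - (-(x * a)) := by
          simp only [smul_eq_mul]; ring
        rw [e, one_nsmul]
        apply Finset.sub_mem_sub
        · apply two_nsmul_mem <;> apply mem_plun <;> assumption
        · apply mem_plun <;> assumption
    _ ≤ (D.card * L) ^ (2 + 1) * A0.card := plun A0 D L hA0 hDY 2 1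
    _ ≤ (4 * L) ^ 3 * A0.card := by gcongr

lemma fsmul_sub (y : F) (A B : Finset F) : y • (A - B) = y • A - y • B := by
  ext x
  constructor
  · intro hx
    obtain ⟨z, hz, rfl⟩ := Finset.mem_smul_finset.1 hx
    obtain ⟨a, ha, b, hb, rfl⟩ := Finset.mem_sub.1 hz
    rw [smul_sub]
    exact Finset.sub_mem_sub (Finset.smul_mem_smul_finset ha) (Finset.smul_mem_smul_finset hb)
  · intro hx
    obtain ⟨u, hu, v, hv, rfl⟩ := Finset.mem_sub.1 hx
    obtain ⟨a, ha, rfl⟩ := Finset.mem_smul_finset.1 hu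
    obtain ⟨b, hb, rfl⟩ := Finset.mem_smul_finset.1 hv
    rw [← smul_sub]
    exact Finset.smul_mem_smul_finset (Finset.sub_mem_sub ha hb)

lemma quot_bound2 (A0 Y : Finset F) (L : ℝ) (hL : 0 ≤ L) (hA0 : A0.Nonempty)
    (hone : ((A0 - A0).card : ℝ) ≤ L * A0.card)
    (hY : ∀ d ∈ Y, ((A0 - d • A0).card : ℝ) ≤ L * A0.card) (r : F) (hr : r ∈ quotSet Y)
    (y : F) (hy : y ∈ Y) (hy0 : y ≠ 0) :
    ((A0 + (y * r) • A0).card : ℝ) ≤ (4 * L) ^ 6 * A0.card := by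
  obtain ⟨x1, h1, x2, h2, x3, h3, x4, h4, hne, rfl⟩ := hr
  have hg : x3 - x4 ≠ 0 := sub_ne_zero.2 hne
  have hpos : (0 : ℝ) < A0.card := by exact_mod_cast hA0.card_pos
  have hinv : ((A0 - y⁻¹ • A0).card : ℝ) ≤ L * A0.card := by
    refine le_trans (le_of_eq ?_) (hY y hy)
    have : y • (A0 - y⁻¹ • A0) = -(A0 - y • A0) := by
      rw [fsmul_sub, smul_smul, mul_inv_cancel₀ hy0, one_smul, neg_sub]
    rw [← Finset.card_smul_finset₀ hy0, this, Finset.card_neg]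
  have b1 := three_bound A0 L hL hA0 x1 x2 y⁻¹ (hY _ h1) (hY _ h2) hinv
  have b2 := three_bound A0 L hL hA0 x4 x3 1 (hY _ h4) (hY _ h3) (by simpa using hone)
  set U := y • (x1 • A0 - x2 • A0) with hU
  set C := x4 • A0 - x3 • A0 with hC
  have b1' : ((U - A0).card : ℝ) ≤ (4 * L) ^ 3 * A0.card := by
    refine le_trans (le_of_eq ?_) b1
    rw [← Finset.card_smul_finset₀ hy0 (x1 • A0 - x2 • A0 - y⁻¹ • A0), fsmul_sub y _ (y⁻¹ • A0),
      smul_smul y y⁻¹, mul_inv_cancel₀ hy0, one_smul]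
  rw [one_smul] at b2
  have t : ((U - C).card : ℝ) * A0.card ≤ (U - A0).card * (C - A0).card := by
    exact_mod_cast Finset.ruzsa_triangle_inequality_sub_sub_sub U A0 C
  have t2 : ((U - C).card : ℝ) * A0.card ≤ ((4 * L) ^ 6 * A0.card) * A0.card := by
    calc _ ≤ _ := t
      _ ≤ ((4 * L) ^ 3 * A0.card) * ((4 * L) ^ 3 * A0.card) := by gcongr
      _ = _ := by ring
  refine le_trans ?_ (le_of_mul_le_mul_right t2 hpos)
  norm_cast
  apply card_le_smul _ _ (x3 - x4) hg
  intro a ha a' ha'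
  have e : (x3 - x4) * (a + y * ((x1 - x2) / (x3 - x4)) * a') =
    y * (x1 * a' - x2 * a') - (x4 * a - x3 * a) := by field_simp; ring
  rw [e]
  apply Finset.sub_mem_sub
  · exact Finset.mem_smul_finset.2 ⟨_, Finset.sub_mem_sub
      (Finset.mem_smul_finset.2 ⟨a', ha', rfl⟩) (Finset.mem_smul_finset.2 ⟨a', ha', rfl⟩), rfl⟩
  · exact Finset.sub_mem_sub
      (Finset.mem_smul_finset.2 ⟨a, ha, rfl⟩) (Finset.mem_smul_finset.2 ⟨a, ha, rfl⟩)

lemma mem_quot_of_small (A0 Y : Finset F) (a c : F) (hc : c ≠ 0) (hY : ∀ y ∈ Y, a + c * y ∈ A0)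
    (r : F) (h : ((A0 + r • A0).card : ℝ) < (Y.card : ℝ) ^ 2) : r ∈ quotSet Y := by
  have hlt : (A0 + r • A0).card < (Y ×ˢ Y).card := by
    rw [Finset.card_product, ← pow_two]; exact_mod_cast h
  obtain ⟨p, hp, p', hp', hne, he⟩ := Finset.exists_ne_map_eq_of_card_lt_of_maps_to hlt
    (f := fun p : F × F => (a + c * p.1) + r * (a + c * p.2)) (by
      intro p hp
      have hp := Finset.mem_product.1 (Finset.mem_coe.1 hp)
      exact Finset.add_mem_add (hY _ hp.1) (Finset.smul_mem_smul_finset (hY _ hp.2)))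
  have hp := Finset.mem_product.1 hp
  have hp' := Finset.mem_product.1 hp'
  have he2 : p.1 + r * p.2 = p'.1 + r * p'.2 := by
    apply mul_left_cancel₀ hc
    have he' : (a + c*p.1)+r*(a+c*p.2) = (a + c*p'.1)+r*(a+c*p'.2) := he
    linear_combination he'
  have h2 : p'.2 ≠ p.2 := by
    intro e
    apply hne
    rw [e] at he2
    exact Prod.ext (add_right_cancel he2) e.symm
  refine ⟨p.1, hp.1, p'.1, hp'.1, p'.2, hp'.2, p.2, hp.2, h2, ?_⟩
  rw [eq_div_iff (sub_ne_zero.2 h2)]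
  linear_combination -he2

lemma exists_few_coll (Y G : Finset F) (hG : G.Nonempty) :
    ∃ r ∈ G, ((((Y ×ˢ Y) ×ˢ (Y ×ˢ Y)).filter
      (fun p => p.1.1 + r * p.1.2 = p.2.1 + r * p.2.2)).card : ℝ) ≤
      (Y.card : ℝ) ^ 4 / G.card + (Y.card : ℝ) ^ 2 := by
  have hpos : (0 : ℝ) < G.card := by exact_mod_cast hG.card_pos
  apply Finset.exists_le_of_sum_le hG
  rw [card_filter_sum G ((Y ×ˢ Y) ×ˢ (Y ×ˢ Y))
    (fun r p => p.1.1 + r * p.1.2 = p.2.1 + r * p.2.2)]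
  rw [Finset.sum_const, nsmul_eq_mul, mul_add, mul_div_cancel₀ _ hpos.ne']
  calc ∑ p ∈ (Y ×ˢ Y) ×ˢ (Y ×ˢ Y),
        ((G.filter (fun r => p.1.1 + r * p.1.2 = p.2.1 + r * p.2.2)).card : ℝ)
      ≤ ∑ p ∈ (Y ×ˢ Y) ×ˢ (Y ×ˢ Y), (1 + if p.1 = p.2 then (G.card : ℝ) else 0) := by
        apply Finset.sum_le_sum
        intro p _
        split_ifs with h
        · have : ((G.filter (fun r => p.1.1 + r * p.1.2 = p.2.1 + r * p.2.2)).card : ℝ) ≤ G.card := by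
            exact_mod_cast Finset.card_le_card (Finset.filter_subset _ _)
          linarith
        · rw [add_zero]
          have : (G.filter (fun r => p.1.1 + r * p.1.2 = p.2.1 + r * p.2.2)).card ≤ 1 := by
            rw [Finset.card_le_one]
            intro x hx y hy
            have hx := (Finset.mem_filter.1 hx).2
            have hy := (Finset.mem_filter.1 hy).2
            have h2 : p.1.2 - p.2.2 ≠ 0 := by
              intro e
              have e' := sub_eq_zero.1 e
              apply h
              rw [e'] at hx
              exact Prod.ext (add_right_cancel hx) e'
            apply mul_right_cancel₀ h2
            linear_combination hx - hy
          exact_mod_cast this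
    _ = (Y.card : ℝ) ^ 4 + G.card * (Y.card : ℝ) ^ 2 := by
        rw [Finset.sum_add_distrib]
        congr 1
        · simp only [Finset.sum_const, nsmul_eq_mul, Finset.card_product]; push_cast; ring
        · rw [Finset.sum_product]
          have : ∀ x ∈ Y ×ˢ Y, ∑ y ∈ Y ×ˢ Y, (if x = y then (G.card : ℝ) else 0) = G.card := by
            intro x hx
            rw [Finset.sum_ite_eq, if_pos hx]
          rw [Finset.sum_congr rfl this, Finset.sum_const, nsmul_eq_mul, Finset.card_product]
          push_cast; ring

lemma alg [Fintype F] (A0 Y : Finset F) (L : ℝ) (hA0 : A0.Nonempty)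
    (hone : ((A0 - A0).card : ℝ) ≤ L * A0.card)
    (hY : ∀ d ∈ Y, ((A0 - d • A0).card : ℝ) ≤ L * A0.card)
    (a c : F) (hc : c ≠ 0) (hYA : ∀ y ∈ Y, a + c * y ∈ A0)
    (hbig : (4 * L) ^ 6 * A0.card < (Y.card : ℝ) ^ 2) :
    ∃ G : Subfield F, (∀ y ∈ Y, y ∈ G) ∧ (Nat.card G : ℝ) ≤ 2 * (4 * L) ^ 4 * A0.card := by
  have hpos : (0 : ℝ) < A0.card := by exact_mod_cast hA0.card_pos
  have hL : 1 ≤ L := by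
    have : (A0.card : ℝ) ≤ (A0 - A0).card := by
      exact_mod_cast Finset.card_le_card_sub_right hA0
    by_contra hlt
    have : L * A0.card < 1 * A0.card := by
      apply mul_lt_mul_of_pos_right (not_le.1 hlt) hpos
    linarith
  have hYpos : (0 : ℝ) < (Y.card : ℝ) ^ 2 := lt_of_le_of_lt (by positivity) hbig
  have h0 : (0 : F) ∈ quotSet Y := by
    apply mem_quot_of_small A0 Y a c hc hYA
    refine lt_of_le_of_lt ?_ hbig
    have h1 : ((A0 + (0 : F) • A0).card : ℝ) ≤ A0.card := by
      have : (0 : F) • A0 = 0 := by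
        exact Finset.zero_smul_finset hA0
      rw [this, add_zero]
    have h2 : (1 : ℝ) ≤ (4 * L) ^ 6 := one_le_pow₀ (by linarith)
    nlinarith
  obtain ⟨G, hG1, hG2⟩ := closure_sub Y (quotSet Y) h0
    (fun r hr => mem_quot_of_small A0 Y a c hc hYA _
      (lt_of_le_of_lt (quot_bound1 A0 Y L (by linarith) hA0 hY r hr).2 hbig))
    (fun y hy hy0 r hr => mem_quot_of_small A0 Y a c hc hYA _
      (lt_of_le_of_lt (quot_bound2 A0 Y L (by linarith) hA0 hone hY r hr y hy hy0) hbig))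
  refine ⟨G, hG1, ?_⟩
  set Gf : Finset F := Finset.univ.filter (fun x => x ∈ G) with hGf
  have hGc : Nat.card G = Gf.card := by
    rw [Nat.card_eq_fintype_card, hGf, Fintype.card_subtype]
  obtain ⟨r, hr, hcoll⟩ := exists_few_coll Y Gf ⟨0, by simp [hGf, G.zero_mem]⟩
  have hrG : r ∈ G := by simpa [hGf] using hr
  have hP := (quot_bound1 A0 Y L (by linarith) hA0 hY r (hG2 r hrG)).1
  have hc1 := coll_ge (Y ×ˢ Y) (A0 + r • A0) (fun p : F × F => (a + c * p.1) + r * (a + c * p.2)) (by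
      intro p hp
      have hp := Finset.mem_product.1 (Finset.mem_coe.1 hp)
      exact Finset.add_mem_add (hYA _ hp.1) (Finset.smul_mem_smul_finset (hYA _ hp.2)))
  have hc2 : ((Y ×ˢ Y) ×ˢ (Y ×ˢ Y)).filter (fun p => (a + c * p.1.1) + r * (a + c * p.1.2) =
      (a + c * p.2.1) + r * (a + c * p.2.2)) = ((Y ×ˢ Y) ×ˢ (Y ×ˢ Y)).filter
      (fun p => p.1.1 + r * p.1.2 = p.2.1 + r * p.2.2) := by
    apply Finset.filter_congr
    intro p _
    constructor
    · intro h
      apply mul_left_cancel₀ hc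
      linear_combination h
    · intro h
      linear_combination c * h
  rw [hc2] at hc1
  rw [hGc]
  have hGpos : (0 : ℝ) < Gf.card := by exact_mod_cast Finset.card_pos.2 ⟨r, hr⟩
  set P := (4 * L) ^ 4 * A0.card with hPdef
  have hPpos : 0 < P := by positivity
  have hP2 : 2 * P ≤ (Y.card : ℝ) ^ 2 := by
    have : 2 * P ≤ (4 * L) ^ 6 * A0.card := by
      have : (2:ℝ) ≤ (4 * L) ^ 2 := by nlinarith
      calc 2 * P ≤ (4 * L) ^ 2 * P := by gcongr
        _ = _ := by rw [hPdef]; ring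
    linarith
  set y := (Y.card : ℝ) ^ 2 with hy
  have e4 : (Y.card : ℝ) ^ 4 = y ^ 2 := by rw [hy]; ring
  rw [e4] at hcoll
  have e5 : (((Y ×ˢ Y).card : ℝ)) = y := by
    rw [Finset.card_product, hy]; push_cast; ring
  rw [e5] at hc1
  have f1 : y ^ 2 ≤ P * (y ^ 2 / Gf.card + y) := by
    refine hc1.trans ?_
    gcongr
  have f2 : P * y ≤ y ^ 2 / 2 := by nlinarith
  have f3 : y ^ 2 / 2 ≤ P * (y ^ 2 / Gf.card) := by linarith
  have f4 : y ^ 2 * Gf.card ≤ y ^ 2 * (2 * P) := by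
    have : P * (y ^ 2 / Gf.card) = P * y ^ 2 / Gf.card := by ring
    rw [this, le_div_iff₀ hGpos] at f3
    linarith
  have f5 := le_of_mul_le_mul_left f4 (by positivity)
  rw [hPdef] at f5
  linarith

lemma sum_inter_ge {α ι : Type*} [DecidableEq α] (U : Finset α) (X : Finset ι) (P : ι → Finset α)
    (hP : ∀ i ∈ X, P i ⊆ U) (m : ℝ) (hm0 : 0 ≤ m) (hm : ∀ i ∈ X, m ≤ (P i).card) :
    ((X.card : ℝ) * m) ^ 2 ≤ U.card * ∑ j ∈ X, ∑ i ∈ X, ((P i ∩ P j).card : ℝ) := by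
  have h1 : ∀ i ∈ X, ((P i).card : ℝ) = ∑ p ∈ U, if p ∈ P i then (1 : ℝ) else 0 := by
    intro i hi
    rw [Finset.sum_boole]
    congr 2
    ext p; simp only [Finset.mem_filter]
    exact ⟨fun h => ⟨hP i hi h, h⟩, fun h => h.2⟩
  have h2 : ∀ j ∈ X, ∀ i ∈ X, ((P i ∩ P j).card : ℝ) =
      ∑ p ∈ U, (if p ∈ P j then (1 : ℝ) else 0) * (if p ∈ P i then (1 : ℝ) else 0) := by
    intro j hj i hi
    have e : ∀ p ∈ U, (if p ∈ P j then (1 : ℝ) else 0) * (if p ∈ P i then (1 : ℝ) else 0) =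
        if p ∈ P j ∧ p ∈ P i then (1 : ℝ) else 0 := by
      intro p _
      by_cases c1 : p ∈ P j <;> by_cases c2 : p ∈ P i <;> simp [c1, c2]
    rw [Finset.sum_congr rfl e, Finset.sum_boole]
    congr 2
    ext p; simp only [Finset.mem_filter, Finset.mem_inter]
    exact ⟨fun h => ⟨hP i hi h.1, h.2, h.1⟩, fun h => ⟨h.2.2, h.2.1⟩⟩
  have h3 : ∑ j ∈ X, ∑ i ∈ X, ((P i ∩ P j).card : ℝ) =
      ∑ p ∈ U, (∑ i ∈ X, if p ∈ P i then (1 : ℝ) else 0) ^ 2 := by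
    rw [Finset.sum_congr rfl (fun j hj => Finset.sum_congr rfl (h2 j hj))]
    simp_rw [pow_two, Finset.sum_mul_sum]
    rw [Finset.sum_comm' (t' := X) (s' := fun _ => X) (by simp)]
    rw [Finset.sum_congr rfl (fun j _ => Finset.sum_comm (s := X) (t := U))]
    rw [Finset.sum_comm]
    refine Finset.sum_congr rfl fun x _ => ?_
    rw [Finset.sum_comm]
  rw [h3]
  refine le_trans ?_ sq_sum_le_card_mul_sum_sq
  rw [Finset.sum_comm]
  have h4 : (X.card : ℝ) * m ≤ ∑ i ∈ X, ∑ p ∈ U, if p ∈ P i then (1 : ℝ) else 0 := by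
    rw [← Finset.sum_congr rfl h1, ← nsmul_eq_mul]
    exact Finset.card_nsmul_le_sum X _ _ hm
  gcongr

lemma ruzsa_dist (A0 B0 A1 B1 : Finset F) (b b0 : F) (hb : b ≠ 0) (hb0 : b0 ≠ 0)
    (hA : A1 ⊆ A0) (hB : B1 ⊆ B0) (S : ℝ) (h0 : ((A0 - b0 • B0).card : ℝ) ≤ S)
    (h1 : ((A1 - b • B1).card : ℝ) ≤ S) :
    ((A0 - A0).card : ℝ) * B0.card ≤ S ^ 2 ∧
    ((A0 - (b / b0) • A0).card : ℝ) * (A1.card * B1.card) ≤ (A0 - A0).card * S ^ 2 := by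
  have hS : 0 ≤ S := le_trans (by positivity) h0
  constructor
  · have t : ((A0 - A0).card : ℝ) * (b0 • B0).card ≤ (A0 - b0 • B0).card * (A0 - b0 • B0).card := by
      exact_mod_cast Finset.ruzsa_triangle_inequality_sub_sub_sub A0 (b0 • B0) A0
    rw [Finset.card_smul_finset₀ hb0] at t
    calc _ ≤ _ := t
      _ ≤ S * S := by gcongr
      _ = S ^ 2 := by ring
  · have t2 : ((A0 - b • B1).card : ℝ) * A1.card ≤ (A0 - A1).card * (b • B1 - A1).card := by
      exact_mod_cast Finset.ruzsa_triangle_inequality_sub_sub_sub A0 A1 (b • B1)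
    have e2 : (b • B1 - A1).card = (A1 - b • B1).card := by
      rw [← Finset.card_neg, neg_sub]
    rw [e2] at t2
    have t3 : ((A0 - (b / b0) • A0).card : ℝ) * (b • B1).card ≤
        (A0 - b • B1).card * ((b / b0) • A0 - b • B1).card := by
      exact_mod_cast Finset.ruzsa_triangle_inequality_sub_sub_sub A0 (b • B1) ((b / b0) • A0)
    rw [Finset.card_smul_finset₀ hb] at t3
    have e3 : (b / b0) • A0 - b • B1 = (b / b0) • (A0 - b0 • B1) := by
      rw [fsmul_sub, smul_smul, div_mul_cancel₀ _ hb0]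
    rw [e3, Finset.card_smul_finset₀ (div_ne_zero hb hb0)] at t3
    have m1 : ((A0 - b0 • B1).card : ℝ) ≤ S := by
      refine le_trans ?_ h0
      have hsub : A0 - b0 • B1 ⊆ A0 - b0 • B0 :=
        Finset.sub_subset_sub subset_rfl (Finset.smul_finset_subset_smul_finset hB)
      exact Nat.cast_le.2 (Finset.card_le_card hsub)
    have m2 : ((A0 - A1).card : ℝ) ≤ (A0 - A0).card := by
      have hsub : A0 - A1 ⊆ A0 - A0 := Finset.sub_subset_sub subset_rfl hA
      exact Nat.cast_le.2 (Finset.card_le_card hsub)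
    calc ((A0 - (b / b0) • A0).card : ℝ) * (A1.card * B1.card)
        = ((A0 - (b / b0) • A0).card : ℝ) * B1.card * A1.card := by ring
      _ ≤ ((A0 - b • B1).card * (A0 - b0 • B1).card) * A1.card := by gcongr
      _ ≤ ((A0 - b • B1).card * S) * A1.card := by gcongr
      _ = ((A0 - b • B1).card * A1.card) * S := by ring
      _ ≤ ((A0 - A1).card * (A1 - b • B1).card) * S := by gcongr
      _ ≤ ((A0 - A0).card * S) * S := by gcongr
      _ = _ := by ring

set_option maxHeartbeats 1600000 in
lemma struct (A X : Finset F) (N K : ℝ) (hN : 0 < N) (hK : 0 < K) (hA : (A.card : ℝ) = N)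
    (hXne : X.Nonempty)
    (hX : ∀ b ∈ X, b ≠ 0 ∧
      N ^ 2 / K ≤ ∑ a ∈ A, ((A.filter (fun c => a - b * c ∈ (1 - b) • A)).card : ℝ))
    (hbig : 2 * (2592 ^ 2 * 3072) * K ^ 13 ≤ N) :
    ∃ A0 ⊆ A, ∃ Y : Finset F, N / (6 * K) ≤ A0.card ∧
      ((A0 - A0).card : ℝ) ≤ 6 * 3072 ^ 2 * K ^ 11 * N ∧
      (∀ y ∈ Y, ((A0 - y • A0).card : ℝ) ≤ 6 * 3072 ^ 4 * 2592 * K ^ 25 * N) ∧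
      (∃ a c : F, c ≠ 0 ∧ ∀ y ∈ Y, a + c * y ∈ A0) ∧
      (X.card : ℝ) / (2592 * (2 * (2592 ^ 2 * 3072)) * K ^ 17) ≤ Y.card := by
  have hbsg : ∀ b ∈ X, ∃ A' ⊆ A, ∃ B' ⊆ A, N / (6 * K) ≤ A'.card ∧ N / (6 * K) ≤ B'.card ∧
      ((A' - b • B').card : ℝ) ≤ 3072 * K ^ 5 * N := by
    intro b hb
    apply bsg_diff A ((1 - b) • A) b (hX b hb).1 N K hN hK hA _ (hX b hb).2
    rw [← hA]; exact_mod_cast Finset.card_image_le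
  choose! Af hAf Bf hBf hAc hBc hAB using hbsg
  set P : F → Finset (F × F) := fun b => Af b ×ˢ Bf b with hP
  have hXpos : (0 : ℝ) < X.card := by exact_mod_cast hXne.card_pos
  have hUc : (((A ×ˢ A).card : ℕ) : ℝ) = N ^ 2 := by
    rw [Finset.card_product]; push_cast; rw [hA]; ring
  have hPsub : ∀ b ∈ X, P b ⊆ A ×ˢ A := fun b hb => Finset.product_subset_product (hAf b hb) (hBf b hb)
  have hsum := sum_inter_ge (A ×ˢ A) X P hPsub (N ^ 2 / (36 * K ^ 2)) (by positivity) (by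
    intro b hb
    rw [hP, Finset.card_product]; push_cast
    calc N ^ 2 / (36 * K ^ 2) = N / (6 * K) * (N / (6 * K)) := by field_simp; norm_num
      _ ≤ _ := mul_le_mul (hAc b hb) (hBc b hb) (by positivity) (by positivity))
  rw [hUc] at hsum
  obtain ⟨b0, hb0X, hb0⟩ : ∃ b0 ∈ X, X.card * (N ^ 2 / (1296 * K ^ 4)) ≤
      ∑ b ∈ X, ((P b ∩ P b0).card : ℝ) := by
    apply Finset.exists_le_of_sum_le hXne
    rw [Finset.sum_const, nsmul_eq_mul]
    have e : ((X.card : ℝ) * (N ^ 2 / (36 * K ^ 2))) ^ 2 =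
      N ^ 2 * (X.card * (X.card * (N ^ 2 / (1296 * K ^ 4)))) := by field_simp; norm_num
    rw [e] at hsum
    exact le_of_mul_le_mul_left hsum (by positivity : (0 : ℝ) < N ^ 2)
  have hb00 := (hX b0 hb0X).1
  set A0 := Af b0 with hA0
  set B0 := Bf b0 with hB0
  set X1 := X.filter (fun b => N ^ 2 / (2592 * K ^ 4) ≤ ((P b ∩ P b0).card : ℝ)) with hX1
  have hX1c : (X.card : ℝ) / (2592 * K ^ 4) ≤ X1.card := by
    have p := popular_sum X (fun b => ((P b ∩ P b0).card : ℝ)) (N ^ 2 / (2592 * K ^ 4)) (by positivity)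
    simp only [← hX1] at p
    have p2 : ∑ b ∈ X1, ((P b ∩ P b0).card : ℝ) ≤ X1.card * N ^ 2 := by
      rw [← nsmul_eq_mul]
      apply Finset.sum_le_card_nsmul
      intro b hb
      rw [← hUc]
      exact_mod_cast Finset.card_le_card (Finset.inter_subset_right.trans (hPsub b0 hb0X))
    have e : X.card * (N ^ 2 / (1296 * K ^ 4)) =
      X.card / (2592 * K ^ 4) * N ^ 2 + X.card * (N ^ 2 / (2592 * K ^ 4)) := by field_simp; norm_num
    have : (X.card : ℝ) / (2592 * K ^ 4) * N ^ 2 ≤ X1.card * N ^ 2 := by linarith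
    exact le_of_mul_le_mul_right this (by positivity)
  have hX1pos : (0 : ℝ) < X1.card := lt_of_lt_of_le (by positivity) hX1c
  have hX1X : ∀ b ∈ X1, b ∈ X := fun b hb => (Finset.mem_filter.1 hb).1
  have hprod : ∀ b ∈ X1, N ^ 2 / (2592 * K ^ 4) ≤
      ((Af b ∩ A0).card : ℝ) * ((Bf b ∩ B0).card : ℝ) := by
    intro b hb
    have h := (Finset.mem_filter.1 hb).2
    simp only [hP] at h
    rw [Finset.product_inter_product, Finset.card_product] at h
    push_cast at h
    exact h
  have hAB1 : ∀ b ∈ X1, (((Af b ∩ A0) - b • (Bf b ∩ B0)).card : ℝ) ≤ 3072 * K ^ 5 * N := by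
    intro b hb
    refine le_trans ?_ (hAB b (hX1X b hb))
    have hsub : (Af b ∩ A0) - b • (Bf b ∩ B0) ⊆ Af b - b • Bf b :=
      Finset.sub_subset_sub Finset.inter_subset_left
        (Finset.smul_finset_subset_smul_finset Finset.inter_subset_left)
    exact Nat.cast_le.2 (Finset.card_le_card hsub)
  have hB0c : N / (6 * K) ≤ (B0.card : ℝ) := hBc b0 hb0X
  have hdiff : ∀ b ∈ X1, ((A0 - A0).card : ℝ) ≤ 6 * 3072 ^ 2 * K ^ 11 * N ∧
      ((A0 - (b / b0) • A0).card : ℝ) ≤ 6 * 3072 ^ 4 * 2592 * K ^ 25 * N := by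
    intro b hb
    obtain ⟨r1, r2⟩ := ruzsa_dist A0 B0 (Af b ∩ A0) (Bf b ∩ B0) b b0 (hX b (hX1X b hb)).1 hb00
      Finset.inter_subset_right Finset.inter_subset_right (3072 * K ^ 5 * N)
      (hAB b0 hb0X) (hAB1 b hb)
    have q1 : ((A0 - A0).card : ℝ) ≤ 6 * 3072 ^ 2 * K ^ 11 * N := by
      have : ((A0 - A0).card : ℝ) * (N / (6 * K)) ≤ (6 * 3072 ^ 2 * K ^ 11 * N) * (N / (6 * K)) := by
        calc ((A0 - A0).card : ℝ) * (N / (6 * K)) ≤ (A0 - A0).card * B0.card := by gcongr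
          _ ≤ _ := r1
          _ = _ := by field_simp
      exact le_of_mul_le_mul_right this (by positivity)
    refine ⟨q1, ?_⟩
    have : ((A0 - (b / b0) • A0).card : ℝ) * (N ^ 2 / (2592 * K ^ 4)) ≤
        (6 * 3072 ^ 4 * 2592 * K ^ 25 * N) * (N ^ 2 / (2592 * K ^ 4)) := by
      calc _ ≤ ((A0 - (b / b0) • A0).card : ℝ) * (((Af b ∩ A0).card : ℝ) * ((Bf b ∩ B0).card : ℝ)) := by
            gcongr; exact hprod b hb
        _ ≤ _ := r2
        _ ≤ (6 * 3072 ^ 2 * K ^ 11 * N) * (3072 * K ^ 5 * N) ^ 2 := by gcongr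
        _ = _ := by field_simp
    exact le_of_mul_le_mul_right this (by positivity)
  set D : ℝ := 2592 ^ 2 * 3072 with hD
  have hDpos : 0 < D := by positivity
  have hen : ∀ b ∈ X1, N ^ 3 / (2 * D * K ^ 13) ≤
      ((((A ×ˢ A ×ˢ A).filter (fun t => t.2.1 ≠ t.2.2)).filter
        (fun t => t.1 + b * (t.2.1 - t.2.2) ∈ A0)).card : ℝ) := by
    intro b hb
    set A1 := Af b ∩ A0 with hA1
    set B1 := Bf b ∩ B0 with hB1
    have hA1A : A1 ⊆ A := Finset.inter_subset_left.trans (hAf b (hX1X b hb))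
    have hB1A : B1 ⊆ A := Finset.inter_subset_left.trans (hBf b (hX1X b hb))
    have hco := coll_ge (A1 ×ˢ B1) (A1 - b • B1) (fun p : F × F => p.1 - b * p.2) (by
      intro p hp
      have hp := Finset.mem_product.1 hp
      exact Finset.sub_mem_sub hp.1 (Finset.smul_mem_smul_finset hp.2))
    set Q := (((A1 ×ˢ B1) ×ˢ (A1 ×ˢ B1)).filter (fun p => p.1.1 - b * p.1.2 = p.2.1 - b * p.2.2)) with hQ
    have hQ1 : N ^ 3 / (D * K ^ 13) ≤ (Q.card : ℝ) := by
      have h1 : (N ^ 2 / (2592 * K ^ 4)) ^ 2 ≤ (3072 * K ^ 5 * N) * Q.card := by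
        calc _ ≤ (((A1 ×ˢ B1).card : ℕ) : ℝ) ^ 2 := by
              gcongr
              rw [Finset.card_product]; push_cast
              exact hprod b hb
          _ ≤ _ := hco
          _ ≤ _ := by gcongr; exact hAB1 b hb
      have e : (N ^ 2 / (2592 * K ^ 4)) ^ 2 = (3072 * K ^ 5 * N) * (N ^ 3 / (D * K ^ 13)) := by
        rw [hD]; field_simp
      rw [e] at h1
      exact le_of_mul_le_mul_left h1 (by positivity)
    have hQ2 : (Q.card : ℝ) ≤ ((((A ×ˢ A ×ˢ A).filter (fun t => t.2.1 ≠ t.2.2)).filter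
        (fun t => t.1 + b * (t.2.1 - t.2.2) ∈ A0)).card : ℝ) + N ^ 2 := by
      have c1 : Q.card ≤ ((A ×ˢ A ×ˢ A).filter
        (fun t => t.1 + b * (t.2.1 - t.2.2) ∈ A0)).card := by
        apply Finset.card_le_card_of_injOn (fun p => (p.2.1, p.1.2, p.2.2))
        · intro p hp
          have hp := Finset.mem_filter.1 (Finset.mem_coe.1 hp)
          simp only [Finset.mem_product] at hp
          obtain ⟨⟨⟨i1, i2⟩, i3, i4⟩, i5⟩ := hp
          apply Finset.mem_coe.2
          refine Finset.mem_filter.2 ⟨?_, ?_⟩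
          · simp only [Finset.mem_product]
            exact ⟨hA1A i3, hB1A i2, hB1A i4⟩
          · have : p.2.1 + b * (p.1.2 - p.2.2) = p.1.1 := by linear_combination -i5
            simp only [this]
            exact (Finset.mem_inter.1 i1).2
        · intro p hp p' hp' h
          have hp := (Finset.mem_filter.1 (Finset.mem_coe.1 hp)).2
          have hp' := (Finset.mem_filter.1 (Finset.mem_coe.1 hp')).2
          simp only [Prod.mk.injEq] at h
          obtain ⟨e1, e2, e3⟩ := h
          have e4 : p.1.1 = p'.1.1 := by
            rw [e1, e2, e3] at hp
            linear_combination hp - hp'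
          exact Prod.ext (Prod.ext e4 e2) (Prod.ext e1 e3)
      have c2 : ((A ×ˢ A ×ˢ A).filter (fun t => t.1 + b * (t.2.1 - t.2.2) ∈ A0)) ⊆
        (((A ×ˢ A ×ˢ A).filter (fun t => t.2.1 ≠ t.2.2)).filter
        (fun t => t.1 + b * (t.2.1 - t.2.2) ∈ A0)) ∪ (A ×ˢ A).image (fun p => (p.1, p.2, p.2)) := by
        intro t ht
        have ht := Finset.mem_filter.1 ht
        have ht1 := ht.1
        simp only [Finset.mem_product] at ht1
        by_cases h : t.2.1 = t.2.2
        · apply Finset.mem_union_right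
          refine Finset.mem_image.2 ⟨(t.1, t.2.1), ?_, ?_⟩
          · exact Finset.mem_product.2 ⟨ht1.1, ht1.2.1⟩
          · exact Prod.ext rfl (Prod.ext rfl h)
        · apply Finset.mem_union_left
          exact Finset.mem_filter.2 ⟨Finset.mem_filter.2 ⟨ht.1, h⟩, ht.2⟩
      have c3 : ((((A ×ˢ A).image (fun p : F × F => (p.1, p.2, p.2))).card : ℕ) : ℝ) ≤ N ^ 2 := by
        rw [← hUc]; exact_mod_cast Finset.card_image_le
      have c4 := (Finset.card_le_card c2).trans (Finset.card_union_le _ _)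
      have c5 := c1.trans c4
      have c6 : (Q.card : ℝ) ≤ ((((A ×ˢ A ×ˢ A).filter (fun t => t.2.1 ≠ t.2.2)).filter
        (fun t => t.1 + b * (t.2.1 - t.2.2) ∈ A0)).card : ℝ) +
          ((((A ×ˢ A).image (fun p : F × F => (p.1, p.2, p.2))).card : ℕ) : ℝ) := by exact_mod_cast c5
      linarith
    have e : N ^ 3 / (D * K ^ 13) = N ^ 3 / (2 * D * K ^ 13) + N ^ 3 / (2 * D * K ^ 13) := by
      field_simp; ring
    have e2 : N ^ 2 ≤ N ^ 3 / (2 * D * K ^ 13) := by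
      rw [le_div_iff₀ (by positivity)]
      calc N ^ 2 * (2 * D * K ^ 13) ≤ N ^ 2 * N := by gcongr
        _ = N ^ 3 := by ring
    linarith
  set T := (A ×ˢ A ×ˢ A).filter (fun t => t.2.1 ≠ t.2.2) with hT
  have hTc : (T.card : ℝ) ≤ N ^ 3 := by
    calc (T.card : ℝ) ≤ (((A ×ˢ A ×ˢ A).card : ℕ) : ℝ) := by
          exact_mod_cast Finset.card_le_card (Finset.filter_subset _ _)
      _ = N ^ 3 := by simp only [Finset.card_product]; push_cast; rw [hA]; ring
  obtain ⟨b1, hb1⟩ : X1.Nonempty := by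
    rw [← Finset.card_pos]; exact_mod_cast hX1pos
  have hTne : T.Nonempty := by
    have h := hen b1 hb1
    have h2 : (0 : ℝ) < ((T.filter (fun t => t.1 + b1 * (t.2.1 - t.2.2) ∈ A0)).card : ℝ) :=
      lt_of_lt_of_le (by positivity) h
    have h3 := Finset.card_pos.1 (by exact_mod_cast h2 :
      0 < (T.filter (fun t => t.1 + b1 * (t.2.1 - t.2.2) ∈ A0)).card)
    exact h3.mono (Finset.filter_subset _ _)
  obtain ⟨t, htT, ht⟩ : ∃ t ∈ T, X1.card / (2 * D * K ^ 13) ≤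
      ((X1.filter (fun b => t.1 + b * (t.2.1 - t.2.2) ∈ A0)).card : ℝ) := by
    apply Finset.exists_le_of_sum_le hTne
    rw [← card_filter_sum X1 T (fun b t => t.1 + b * (t.2.1 - t.2.2) ∈ A0)]
    calc ∑ i ∈ T, (X1.card : ℝ) / (2 * D * K ^ 13) = T.card * (X1.card / (2 * D * K ^ 13)) := by simp
      _ ≤ N ^ 3 * (X1.card / (2 * D * K ^ 13)) := by gcongr
      _ = X1.card * (N ^ 3 / (2 * D * K ^ 13)) := by ring
      _ ≤ _ := by
        rw [← nsmul_eq_mul]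
        exact Finset.card_nsmul_le_sum X1 _ _ hen
  set Xt := X1.filter (fun b => t.1 + b * (t.2.1 - t.2.2) ∈ A0) with hXt
  refine ⟨A0, hAf b0 hb0X, Xt.image (fun b => b / b0), hAc b0 hb0X, (hdiff b1 hb1).1, ?_, ?_, ?_⟩
  · intro y hy
    obtain ⟨b, hb, rfl⟩ := Finset.mem_image.1 hy
    exact (hdiff b (Finset.mem_filter.1 hb).1).2
  · refine ⟨t.1, (t.2.1 - t.2.2) * b0, mul_ne_zero (sub_ne_zero.2 (Finset.mem_filter.1 htT).2) hb00, ?_⟩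
    intro y hy
    obtain ⟨b, hb, rfl⟩ := Finset.mem_image.1 hy
    have e : t.1 + (t.2.1 - t.2.2) * b0 * (b / b0) = t.1 + b * (t.2.1 - t.2.2) := by
      field_simp
    rw [e]
    exact (Finset.mem_filter.1 hb).2
  · rw [Finset.card_image_of_injective]
    · refine le_trans ?_ ht
      calc (X.card : ℝ) / (2592 * (2 * D) * K ^ 17) = X.card / (2592 * K ^ 4) / (2 * D * K ^ 13) := by
            field_simp
        _ ≤ _ := by gcongr
    · intro x y h
      exact (div_left_inj' hb00).1 h

def cnt (A : Finset F) (b1 b2 b3 : F) : ℕ :=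
  ((A ×ˢ A ×ˢ A).filter fun x => (x.2.1 - x.1) * (b3 - b1) = (x.2.2 - x.1) * (b2 - b1)).card

lemma coll_eq_sum (A B : Finset F) :
    collinearTriples A B = ∑ b1 ∈ B, ∑ b2 ∈ B, ∑ b3 ∈ B, cnt A b1 b2 b3 := by
  unfold collinearTriples cnt
  rw [Finset.card_filter, Finset.sum_product_right, Finset.sum_product]
  refine Finset.sum_congr rfl fun b1 _ => ?_
  rw [Finset.sum_product]
  refine Finset.sum_congr rfl fun b2 _ => Finset.sum_congr rfl fun b3 _ => ?_
  rw [Finset.card_filter]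

lemma cnt_le_cube (A : Finset F) (b1 b2 b3 : F) : cnt A b1 b2 b3 ≤ A.card ^ 3 := by
  unfold cnt
  refine (Finset.card_le_card (Finset.filter_subset _ _)).trans ?_
  simp only [Finset.card_product]
  exact le_of_eq (by ring)

lemma cnt_le_sq (A : Finset F) (b1 b2 b3 : F) (h : b3 ≠ b1) : cnt A b1 b2 b3 ≤ A.card ^ 2 := by
  unfold cnt
  have : A.card ^ 2 = (A ×ˢ A).card := by rw [Finset.card_product, pow_two]
  rw [this]
  apply Finset.card_le_card_of_injOn (fun x => (x.1, x.2.2))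
  · intro x hx
    have hx := (Finset.mem_filter.1 (Finset.mem_coe.1 hx)).1
    simp only [Finset.mem_product] at hx
    exact Finset.mem_coe.2 (Finset.mem_product.2 ⟨hx.1, hx.2.2⟩)
  · intro x hx y hy hxy
    have hx := (Finset.mem_filter.1 (Finset.mem_coe.1 hx)).2
    have hy := (Finset.mem_filter.1 (Finset.mem_coe.1 hy)).2
    simp only [Prod.mk.injEq] at hxy
    obtain ⟨e1, e2⟩ := hxy
    have e3 : x.2.1 = y.2.1 := by
      apply mul_right_cancel₀ (sub_ne_zero.2 h)
      rw [e1, e2] at hx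
      linear_combination hx - hy
    exact Prod.ext e1 (Prod.ext e3 e2)

lemma cnt_le_sq' (A : Finset F) (b1 b2 b3 : F) (h : b2 ≠ b1) : cnt A b1 b2 b3 ≤ A.card ^ 2 := by
  unfold cnt
  have : A.card ^ 2 = (A ×ˢ A).card := by rw [Finset.card_product, pow_two]
  rw [this]
  apply Finset.card_le_card_of_injOn (fun x => (x.1, x.2.1))
  · intro x hx
    have hx := (Finset.mem_filter.1 (Finset.mem_coe.1 hx)).1
    simp only [Finset.mem_product] at hx
    exact Finset.mem_coe.2 (Finset.mem_product.2 ⟨hx.1, hx.2.1⟩)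
  · intro x hx y hy hxy
    have hx := (Finset.mem_filter.1 (Finset.mem_coe.1 hx)).2
    have hy := (Finset.mem_filter.1 (Finset.mem_coe.1 hy)).2
    simp only [Prod.mk.injEq] at hxy
    obtain ⟨e1, e2⟩ := hxy
    have e3 : x.2.2 = y.2.2 := by
      apply mul_right_cancel₀ (sub_ne_zero.2 h)
      rw [e1, e2] at hx
      linear_combination hy - hx
    exact Prod.ext e1 (Prod.ext e2 e3)

lemma cnt_le_sum (A : Finset F) (b1 b2 b3 : F) (h12 : b2 ≠ b1) (h23 : b3 ≠ b2) :
    (cnt A b1 b2 b3 : ℝ) ≤ ∑ a ∈ A, ((A.filter (fun c =>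
      a - ((b3 - b1) / (b2 - b1)) * c ∈ (1 - (b3 - b1) / (b2 - b1)) • A)).card : ℝ) := by
  have hd := sub_ne_zero.2 h12
  set b := (b3 - b1) / (b2 - b1) with hb
  have hbd : b3 - b1 = b * (b2 - b1) := by rw [hb, div_mul_cancel₀ _ hd]
  have hb1 : 1 - b ≠ 0 := by
    intro e
    have e' : b = 1 := (sub_eq_zero.1 e).symm
    rw [e', one_mul] at hbd
    exact h23 (sub_left_injective hbd)
  rw [← Nat.cast_sum, Nat.cast_le, ← Finset.card_sigma]
  unfold cnt
  have key : ∀ x : F × F × F, (x.2.1 - x.1) * (b3 - b1) = (x.2.2 - x.1) * (b2 - b1) →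
      x.2.2 - b * x.2.1 = (1 - b) * x.1 := by
    intro x hx
    rw [hbd] at hx
    apply mul_right_cancel₀ hd
    linear_combination -hx
  apply Finset.card_le_card_of_injOn (fun x => (⟨x.2.2, x.2.1⟩ : Σ _ : F, F))
  · intro x hx
    obtain ⟨hx, he⟩ := (Finset.mem_filter.1 (Finset.mem_coe.1 hx))
    simp only [Finset.mem_product] at hx
    refine Finset.mem_coe.2 (Finset.mem_sigma.2 ⟨hx.2.2, Finset.mem_filter.2 ⟨hx.2.1, ?_⟩⟩)
    simp only [key x he]
    exact Finset.smul_mem_smul_finset hx.1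
  · intro x hx y hy hxy
    have hx := key x (Finset.mem_filter.1 (Finset.mem_coe.1 hx)).2
    have hy := key y (Finset.mem_filter.1 (Finset.mem_coe.1 hy)).2
    simp only [Sigma.mk.injEq, heq_eq_eq] at hxy
    obtain ⟨e1, e2⟩ := hxy
    have e3 : x.1 = y.1 := by
      apply mul_left_cancel₀ hb1
      rw [← hx, ← hy, e1, e2]
    exact Prod.ext e3 (Prod.ext e2 e1)

lemma exists_pair (A B : Finset F) (N M T : ℝ) (hA : (A.card : ℝ) = N) (hB : (B.card : ℝ) = M)
    (hM : 0 < M) (hMN : M ≤ N) (hT : (collinearTriples A B : ℝ) = T)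
    (hbig : 8 * N ^ 3 * M < T) :
    ∃ b1 ∈ B, ∃ b2 ∈ B, b2 ≠ b1 ∧
      T / (2 * M ^ 2) ≤ ∑ b3 ∈ B, (cnt A b1 b2 b3 : ℝ) := by
  by_contra hcon
  push Not at hcon
  have hN : 0 < N := lt_of_lt_of_le hM hMN
  have hT0 : 0 < T := lt_trans (by positivity) hbig
  have hd : ∀ b1 ∈ B, ∑ b3 ∈ B, (cnt A b1 b1 b3 : ℝ) ≤ N ^ 3 + M * N ^ 2 := by
    intro b1 hb1
    calc ∑ b3 ∈ B, (cnt A b1 b1 b3 : ℝ)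
        ≤ ∑ b3 ∈ B, ((if b3 = b1 then N ^ 3 else 0) + N ^ 2) := by
          apply Finset.sum_le_sum
          intro b3 _
          split_ifs with h
          · have : (cnt A b1 b1 b3 : ℝ) ≤ N ^ 3 := by
              rw [← hA]; exact_mod_cast cnt_le_cube A b1 b1 b3
            nlinarith [sq_nonneg N]
          · rw [zero_add, ← hA]; exact_mod_cast cnt_le_sq A b1 b1 b3 h
      _ = _ := by
          rw [Finset.sum_add_distrib, Finset.sum_ite_eq', if_pos hb1, Finset.sum_const,
            nsmul_eq_mul, hB]
  have hall : ∀ b1 ∈ B, ∀ b2 ∈ B, ∑ b3 ∈ B, (cnt A b1 b2 b3 : ℝ) ≤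
      (if b2 = b1 then N ^ 3 + M * N ^ 2 else 0) + T / (2 * M ^ 2) := by
    intro b1 h1 b2 h2
    split_ifs with h
    · subst h
      have := hd b2 h2
      have : 0 ≤ T / (2 * M ^ 2) := by positivity
      linarith [hd b2 h2]
    · rw [zero_add]; exact (hcon b1 h1 b2 h2 h).le
  have hs : T ≤ M * (N ^ 3 + M * N ^ 2) + M * (M * (T / (2 * M ^ 2))) := by
    calc T = ∑ b1 ∈ B, ∑ b2 ∈ B, ∑ b3 ∈ B, (cnt A b1 b2 b3 : ℝ) := by
          rw [← hT, coll_eq_sum]; push_cast; rfl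
      _ ≤ ∑ b1 ∈ B, ∑ b2 ∈ B, ((if b2 = b1 then N ^ 3 + M * N ^ 2 else 0) + T / (2 * M ^ 2)) :=
          Finset.sum_le_sum fun b1 h1 => Finset.sum_le_sum fun b2 h2 => hall b1 h1 b2 h2
      _ = ∑ b1 ∈ B, ((N ^ 3 + M * N ^ 2) + M * (T / (2 * M ^ 2))) := by
          refine Finset.sum_congr rfl fun b1 h1 => ?_
          rw [Finset.sum_add_distrib, Finset.sum_ite_eq', if_pos h1, Finset.sum_const,
            nsmul_eq_mul, hB]
      _ = _ := by rw [Finset.sum_const, nsmul_eq_mul, hB]; ring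
  have e : M * (M * (T / (2 * M ^ 2))) = T / 2 := by field_simp
  rw [e] at hs
  have : M * (M * N ^ 2) ≤ M * (N * N ^ 2) := by gcongr
  have : 0 < N ^ 3 * M := by positivity
  nlinarith

lemma red (A B : Finset F) (N M T : ℝ) (hA : (A.card : ℝ) = N) (hB : (B.card : ℝ) = M)
    (hM : 0 < M) (hMN : M ≤ N) (hT : (collinearTriples A B : ℝ) = T)
    (hbig : 8 * N ^ 3 * M < T) (K : ℝ) (hK : K = 8 * N ^ 2 * M ^ 3 / T) :
    1 ≤ K ∧ ∃ X : Finset F, M / K ≤ X.card ∧ ∀ b ∈ X, b ≠ 0 ∧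
      N ^ 2 / K ≤ ∑ a ∈ A, ((A.filter (fun c => a - b * c ∈ (1 - b) • A)).card : ℝ) := by
  have hN : 0 < N := lt_of_lt_of_le hM hMN
  have hT0 : 0 < T := lt_trans (by positivity) hbig
  have hK0 : 0 < K := by rw [hK]; positivity
  obtain ⟨b1, hb1, b2, hb2, h12, hs⟩ := exists_pair A B N M T hA hB hM hMN hT hbig
  have hTe : T = 8 * N ^ 2 * M ^ 3 / K := by rw [hK]; field_simp
  have hle : ∀ b3, (cnt A b1 b2 b3 : ℝ) ≤ N ^ 2 := by
    intro b3
    rw [← hA]; exact_mod_cast cnt_le_sq' A b1 b2 b3 h12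
  have hK1 : 1 ≤ K := by
    have : T / (2 * M ^ 2) ≤ M * N ^ 2 := by
      refine hs.trans ?_
      rw [← hB, ← nsmul_eq_mul]
      exact Finset.sum_le_card_nsmul _ _ _ fun b3 _ => hle b3
    rw [div_le_iff₀ (by positivity)] at this
    rw [hK, le_div_iff₀ hT0]
    have : 0 < N ^ 2 * M ^ 3 := by positivity
    nlinarith
  refine ⟨hK1, ?_⟩
  set B' := B.filter (fun b3 => b3 ≠ b1 ∧ b3 ≠ b2) with hB'
  set B2 := B'.filter (fun b3 => N ^ 2 / K ≤ (cnt A b1 b2 b3 : ℝ)) with hB2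
  have hcard : M / K ≤ B2.card := by
    have s1 : ∑ b3 ∈ B, (cnt A b1 b2 b3 : ℝ) ≤ ∑ b3 ∈ B, ((if b3 = b1 then N ^ 2 else 0) +
        (if b3 = b2 then N ^ 2 else 0) + ((if N ^ 2 / K ≤ (cnt A b1 b2 b3 : ℝ) ∧ (b3 ≠ b1 ∧ b3 ≠ b2) then N ^ 2 else 0)
          + N ^ 2 / K)) := by
      apply Finset.sum_le_sum
      intro b3 _
      have h1 := hle b3
      have h2 : 0 ≤ N ^ 2 := by positivity
      have h3 : 0 ≤ N ^ 2 / K := by positivity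
      by_cases c1 : b3 = b1
      · simp only [if_pos c1]
        split_ifs <;> linarith
      by_cases c2 : b3 = b2
      · simp only [if_pos c2]
        split_ifs <;> linarith
      by_cases c3 : N ^ 2 / K ≤ (cnt A b1 b2 b3 : ℝ)
      · rw [if_neg c1, if_neg c2, if_pos (And.intro c3 (And.intro c1 c2))]; linarith
      · have : ¬ (N ^ 2 / K ≤ (cnt A b1 b2 b3 : ℝ) ∧ (b3 ≠ b1 ∧ b3 ≠ b2)) := fun h => c3 h.1
        rw [if_neg this, if_neg c1, if_neg c2]; linarith
    have s2 : B2 = B.filter (fun b3 => N ^ 2 / K ≤ (cnt A b1 b2 b3 : ℝ) ∧ (b3 ≠ b1 ∧ b3 ≠ b2)) := by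
      ext x; simp only [hB2, hB', Finset.mem_filter]; tauto
    rw [Finset.sum_add_distrib, Finset.sum_add_distrib, Finset.sum_add_distrib,
      Finset.sum_ite_eq', Finset.sum_ite_eq', if_pos hb1, if_pos hb2, Finset.sum_const,
      nsmul_eq_mul, hB, ← Finset.sum_filter, ← s2, Finset.sum_const, nsmul_eq_mul] at s1
    have s3 := hs.trans s1
    have e1 : T / (2 * M ^ 2) = 4 * N ^ 2 * (M / K) := by rw [hTe]; field_simp; norm_num
    have e2 : 4 * N ^ 2 ≤ T / (2 * M ^ 2) := by
      rw [le_div_iff₀ (by positivity)]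
      have : N ^ 2 * M * M ≤ N ^ 2 * M * N := by gcongr
      nlinarith
    have e3 : M * (N ^ 2 / K) = N ^ 2 * (M / K) := by ring
    rw [e3] at s3
    have : N ^ 2 * (M / K) ≤ N ^ 2 * B2.card := by linarith
    exact le_of_mul_le_mul_left this (by positivity)
  have hd := sub_ne_zero.2 h12
  refine ⟨B2.image (fun b3 => (b3 - b1) / (b2 - b1)), ?_, ?_⟩
  · rw [Finset.card_image_of_injective]
    · exact hcard
    · intro x y h
      exact sub_left_injective ((div_left_inj' hd).1 h)
  · intro b hb
    obtain ⟨b3, hb3, rfl⟩ := Finset.mem_image.1 hb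
    obtain ⟨hb3, hc⟩ := Finset.mem_filter.1 hb3
    obtain ⟨_, h1, h2⟩ := Finset.mem_filter.1 hb3
    exact ⟨div_ne_zero (sub_ne_zero.2 h1) hd, hc.trans (cnt_le_sum A b1 b2 b3 h12 h2)⟩

def cM : ℝ := 6 * 3072 ^ 4 * 2592
def cD : ℝ := 2592 * (2 * (2592 ^ 2 * 3072))
def cE1 : ℝ := 4 ^ 6 * (6 * cM) ^ 5 * cM
def cE2 : ℝ := 2 * 4 ^ 4 * (6 * cM) ^ 3 * cM

lemma core [Fintype F] (A X : Finset F) (N K : ℝ) (hN : 0 < N) (hK : 1 ≤ K)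
    (hA : (A.card : ℝ) = N) (hXne : X.Nonempty)
    (hX : ∀ b ∈ X, b ≠ 0 ∧
      N ^ 2 / K ≤ ∑ a ∈ A, ((A.filter (fun c => a - b * c ∈ (1 - b) • A)).card : ℝ))
    (hbig : 2 * (2592 ^ 2 * 3072) * K ^ 13 ≤ N)
    (hbig2 : cE1 * K ^ 155 * N < ((X.card : ℝ) / (cD * K ^ 17)) ^ 2) :
    ∃ (Y : Finset F) (G : Subfield F) (a c : F), c ≠ 0 ∧ (∀ y ∈ Y, a + c * y ∈ A) ∧
      (∀ y ∈ Y, y ∈ G) ∧ (Nat.card G : ℝ) ≤ cE2 * K ^ 103 * N ∧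
      (X.card : ℝ) / (cD * K ^ 17) ≤ Y.card := by
  have hK0 : 0 < K := by linarith
  have hcM : 0 < cM := by unfold cM; positivity
  have hcD : 0 < cD := by unfold cD; positivity
  obtain ⟨A0, hA0A, Y, hA0, hdiff, hYd, ⟨a, c, hc, hac⟩, hYc⟩ :=
    struct A X N K hN hK0 hA hXne hX hbig
  have hA0pos : (0 : ℝ) < A0.card := lt_of_lt_of_le (by positivity) hA0
  have hA0ne : A0.Nonempty := Finset.card_pos.1 (by exact_mod_cast hA0pos)
  set L : ℝ := cM * K ^ 25 * N / A0.card with hL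
  have hLA : L * A0.card = cM * K ^ 25 * N := by rw [hL]; field_simp
  have hLpos : 0 < L := by positivity
  have hL2 : L ≤ 6 * cM * K ^ 26 := by
    rw [hL, div_le_iff₀ hA0pos]
    calc cM * K ^ 25 * N = 6 * cM * K ^ 26 * (N / (6 * K)) := by field_simp
      _ ≤ _ := by gcongr
  obtain ⟨G, hG1, hG2⟩ := alg A0 Y L hA0ne (by
      rw [hLA]
      refine hdiff.trans ?_
      have h1 : K ^ 11 ≤ K ^ 25 := pow_le_pow_right₀ hK (by norm_num)
      have h2 : (6 * 3072 ^ 2 : ℝ) ≤ cM := by unfold cM; norm_num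
      gcongr) (by
      intro d hd
      rw [hLA]; exact hYd d hd) a c hc hac (by
      calc (4 * L) ^ 6 * A0.card = 4 ^ 6 * L ^ 5 * (L * A0.card) := by ring
        _ = 4 ^ 6 * L ^ 5 * (cM * K ^ 25 * N) := by rw [hLA]
        _ ≤ 4 ^ 6 * (6 * cM * K ^ 26) ^ 5 * (cM * K ^ 25 * N) := by gcongr
        _ = cE1 * K ^ 155 * N := by unfold cE1; ring
        _ < _ := hbig2
        _ ≤ _ := by
          have := hYc
          have h0 : 0 ≤ (X.card : ℝ) / (cD * K ^ 17) := by positivity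
          exact pow_le_pow_left₀ h0 this 2)
  refine ⟨Y, G, a, c, hc, fun y hy => hA0A (hac y hy), hG1, hG2.trans ?_, hYc⟩
  calc 2 * (4 * L) ^ 4 * A0.card = 2 * 4 ^ 4 * L ^ 3 * (L * A0.card) := by ring
    _ = 2 * 4 ^ 4 * L ^ 3 * (cM * K ^ 25 * N) := by rw [hLA]
    _ ≤ 2 * 4 ^ 4 * (6 * cM * K ^ 26) ^ 3 * (cM * K ^ 25 * N) := by gcongr
    _ = cE2 * K ^ 103 * N := by unfold cE2; ring

lemma rp1 (N M T K c : ℝ) (hN : 0 < N) (hM : 0 < M) (hT : 0 < T) (hc : 0 < c)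
    (hK : K = 8 * N ^ 2 * M ^ 3 / T)
    (h : 8 * c * (N ^ ((383:ℝ)/191) * M ^ ((571:ℝ)/191)) < T) :
    (c * K) ^ 191 * N ≤ M ^ 2 := by
  have hK0 : 0 < K := by rw [hK]; positivity
  have hTe : T = 8 * N ^ 2 * M ^ 3 / K := by rw [hK]; field_simp
  have e1 : N ^ ((383:ℝ)/191) = N ^ 2 * N ^ ((1:ℝ)/191) := by
    rw [← Real.rpow_natCast N 2, ← Real.rpow_add hN]; norm_num
  have e2 : M ^ 3 = M ^ ((571:ℝ)/191) * M ^ ((2:ℝ)/191) := by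
    rw [← Real.rpow_natCast M 3, ← Real.rpow_add hM]; norm_num
  rw [hTe, e2, e1, lt_div_iff₀ hK0] at h
  have hm : 0 < M ^ ((571:ℝ)/191) := by positivity
  have h2 : c * K * N ^ ((1:ℝ)/191) ≤ M ^ ((2:ℝ)/191) := by
    have : (8 * N ^ 2 * M ^ ((571:ℝ)/191)) * (c * K * N ^ ((1:ℝ)/191)) ≤
        (8 * N ^ 2 * M ^ ((571:ℝ)/191)) * M ^ ((2:ℝ)/191) := by linarith
    exact le_of_mul_le_mul_left this (by positivity)
  have h3 := pow_le_pow_left₀ (by positivity) h2 191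
  have e3 : (N ^ ((1:ℝ)/191)) ^ 191 = N := by
    rw [← Real.rpow_natCast, ← Real.rpow_mul hN.le]; norm_num
  have e4 : (M ^ ((2:ℝ)/191)) ^ 191 = M ^ 2 := by
    rw [← Real.rpow_natCast, ← Real.rpow_mul hM.le, ← Real.rpow_natCast]; norm_num
  rw [mul_pow, e3, e4] at h3
  exact h3

lemma rp2 (N M T K c q : ℝ) (hN : 0 < N) (hM : 0 < M) (hT : 0 < T) (hc : 0 < c) (hq : 0 < q)
    (hK : K = 8 * N ^ 2 * M ^ 3 / T)
    (h : 8 * c * (q ^ (-(1:ℝ)/103) * N ^ ((207:ℝ)/103) * M ^ 3) < T) :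
    (c * K) ^ 103 * N < q := by
  have hK0 : 0 < K := by rw [hK]; positivity
  have hTe : T = 8 * N ^ 2 * M ^ 3 / K := by rw [hK]; field_simp
  have e1 : N ^ ((207:ℝ)/103) = N ^ 2 * N ^ ((1:ℝ)/103) := by
    rw [← Real.rpow_natCast N 2, ← Real.rpow_add hN]; norm_num
  have e2 : q ^ (-(1:ℝ)/103) = (q ^ ((1:ℝ)/103))⁻¹ := by
    rw [← Real.rpow_neg hq.le]; norm_num
  have hqp : 0 < q ^ ((1:ℝ)/103) := by positivity
  rw [hTe, e2, e1, lt_div_iff₀ hK0] at h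
  have h2 : c * K * N ^ ((1:ℝ)/103) < q ^ ((1:ℝ)/103) := by
    have e : 8 * c * ((q ^ ((1:ℝ)/103))⁻¹ * (N ^ 2 * N ^ ((1:ℝ)/103)) * M ^ 3) * K =
      (8 * N ^ 2 * M ^ 3) * ((c * K * N ^ ((1:ℝ)/103)) / q ^ ((1:ℝ)/103)) := by
      rw [div_eq_mul_inv]; ring
    rw [e] at h
    have h5 : (8 * N ^ 2 * M ^ 3) * ((c * K * N ^ ((1:ℝ)/103)) / q ^ ((1:ℝ)/103)) <
      (8 * N ^ 2 * M ^ 3) * 1 := by linarith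
    have h6 := lt_of_mul_lt_mul_left h5 (by positivity)
    rwa [div_lt_one hqp] at h6
  have h3 := pow_lt_pow_left₀ h2 (by positivity) (n := 103) (by norm_num)
  have e3 : (N ^ ((1:ℝ)/103)) ^ 103 = N := by
    rw [← Real.rpow_natCast, ← Real.rpow_mul hN.le]; norm_num
  have e4 : (q ^ ((1:ℝ)/103)) ^ 103 = q := by
    rw [← Real.rpow_natCast, ← Real.rpow_mul hq.le]; norm_num
  rw [mul_pow, e3, e4] at h3
  exact h3

lemma rp3 (N M K c : ℝ) (hN : 0 < N) (hM : 0 < M) (hK : 0 < K) (hc : 0 < c)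
    (h : (c * K) ^ 191 * N ≤ M ^ 2) :
    (c * K) ^ 31 * (N ^ ((31:ℝ)/191) * M ^ ((129:ℝ)/191)) ≤ M := by
  have h1 := Real.rpow_le_rpow (by positivity) h (by norm_num : (0:ℝ) ≤ 31/191)
  have e1 : ((c * K) ^ 191 * N) ^ ((31:ℝ)/191) = (c * K) ^ 31 * N ^ ((31:ℝ)/191) := by
    rw [Real.mul_rpow (by positivity) hN.le, ← Real.rpow_natCast (c * K) 191,
      ← Real.rpow_mul (by positivity), ← Real.rpow_natCast (c * K) 31]
    norm_num
  have e2 : (M ^ 2) ^ ((31:ℝ)/191) = M ^ ((62:ℝ)/191) := by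
    rw [← Real.rpow_natCast M 2, ← Real.rpow_mul hM.le]; norm_num
  have e3 : M ^ ((62:ℝ)/191) * M ^ ((129:ℝ)/191) = M := by
    rw [← Real.rpow_add hM]; norm_num
  rw [e1, e2] at h1
  calc (c * K) ^ 31 * (N ^ ((31:ℝ)/191) * M ^ ((129:ℝ)/191))
      = ((c * K) ^ 31 * N ^ ((31:ℝ)/191)) * M ^ ((129:ℝ)/191) := by ring
    _ ≤ M ^ ((62:ℝ)/191) * M ^ ((129:ℝ)/191) := by gcongr
    _ = M := e3

lemma finish [Fintype F] (C c : ℝ) (hC : 0 < C) (hc1 : 1 ≤ c) (hc2 : 2 * (2592 ^ 2 * 3072) ≤ c)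
    (hc3 : cE1 * cD ^ 2 < c) (hc4 : cE2 ≤ c) (hc5 : C ^ 2 * cE2 * cD ^ 2 < c) (hc6 : C * cD < c)
    (A B : Finset F) (hB2 : 2 ≤ B.card) (hBA : B.card ≤ A.card)
    (hsub : subfieldCond A C ((A.card : ℝ) ^ ((31:ℝ)/191) * (B.card : ℝ) ^ ((129:ℝ)/191)))
    (h1 : 8 * c * ((A.card : ℝ) ^ ((383:ℝ)/191) * (B.card : ℝ) ^ ((571:ℝ)/191)) <
      collinearTriples A B)
    (h2 : 8 * c * ((Fintype.card F : ℝ) ^ (-(1:ℝ)/103) * (A.card : ℝ) ^ ((207:ℝ)/103) *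
      (B.card : ℝ) ^ 3) < collinearTriples A B)
    (h3 : 8 * (A.card : ℝ) ^ 3 * B.card < collinearTriples A B) : False := by
  have hcD : 0 < cD := by unfold cD; positivity
  have hcM : 0 < cM := by unfold cM; positivity
  have hcE1 : 0 < cE1 := by unfold cE1; positivity
  have hcE2 : 0 < cE2 := by unfold cE2; positivity
  set N : ℝ := (A.card : ℝ) with hN
  set M : ℝ := (B.card : ℝ) with hM
  set T : ℝ := (collinearTriples A B : ℝ) with hT
  have hM0 : 0 < M := by rw [hM]; exact_mod_cast (by omega : 0 < B.card)
  have hMN : M ≤ N := by rw [hM, hN]; exact_mod_cast hBA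
  have hN0 : 0 < N := lt_of_lt_of_le hM0 hMN
  have hT0 : 0 < T := lt_trans (by positivity) h3
  have hc0 : 0 < c := by linarith
  have hq0 : (0 : ℝ) < Fintype.card F := by exact_mod_cast Fintype.card_pos
  obtain ⟨K, hK⟩ : ∃ K : ℝ, K = 8 * N ^ 2 * M ^ 3 / T := ⟨_, rfl⟩
  obtain ⟨hK1, X, hXc, hX⟩ := red A B N M T rfl rfl hM0 hMN rfl h3 K hK
  have hK0 : 0 < K := by linarith
  have f1 := rp1 N M T K c hN0 hM0 hT0 hc0 hK h1
  have f2 := rp2 N M T K c _ hN0 hM0 hT0 hc0 hq0 hK h2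
  have f3 := rp3 N M K c hN0 hM0 hK0 hc0 f1
  have hXpos : (0 : ℝ) < X.card := lt_of_lt_of_le (by positivity) hXc
  have hXne : X.Nonempty := Finset.card_pos.1 (by exact_mod_cast hXpos)
  have f1' : c * K ^ 191 * N ≤ M ^ 2 := by
    refine le_trans ?_ f1
    rw [mul_pow]
    have : c ≤ c ^ 191 := le_self_pow₀ hc1 (by norm_num)
    gcongr
  have hXl : M / (cD * K ^ 18) ≤ (X.card : ℝ) / (cD * K ^ 17) := by
    calc M / (cD * K ^ 18) = (M / K) / (cD * K ^ 17) := by field_simp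
      _ ≤ _ := by gcongr
  have hsq : (M / (cD * K ^ 18)) ^ 2 ≤ ((X.card : ℝ) / (cD * K ^ 17)) ^ 2 :=
    pow_le_pow_left₀ (by positivity) hXl 2
  have hMsq : (c / cD ^ 2) * K ^ 155 * N ≤ (M / (cD * K ^ 18)) ^ 2 := by
    rw [div_pow, le_div_iff₀ (by positivity)]
    calc (c / cD ^ 2) * K ^ 155 * N * (cD * K ^ 18) ^ 2 = c * K ^ 191 * N := by field_simp
      _ ≤ _ := f1'
  have hbig : 2 * (2592 ^ 2 * 3072) * K ^ 13 ≤ N := by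
    have i1 : c * K ^ 191 ≤ M := by
      have : (c * K ^ 191) * M ≤ M * M := by
        calc (c * K ^ 191) * M ≤ c * K ^ 191 * N := by gcongr
          _ ≤ M ^ 2 := f1'
          _ = M * M := by ring
      exact le_of_mul_le_mul_right this hM0
    have i2 : K ^ 13 ≤ K ^ 191 := pow_le_pow_right₀ hK1 (by norm_num)
    calc 2 * (2592 ^ 2 * 3072) * K ^ 13 ≤ c * K ^ 191 := by gcongr
      _ ≤ N := i1.trans hMN
  have hbig2 : cE1 * K ^ 155 * N < ((X.card : ℝ) / (cD * K ^ 17)) ^ 2 := by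
    refine lt_of_lt_of_le ?_ (hMsq.trans hsq)
    have : cE1 < c / cD ^ 2 := by rw [lt_div_iff₀ (by positivity)]; exact hc3
    gcongr
  obtain ⟨Y, G, a, d, hd, hYA, hYG, hGc, hYc⟩ := core A X N K hN0 hK1 rfl hXne hX hbig hbig2
  have hYl := hXl.trans hYc
  by_cases hG : G = ⊤
  · have : (Nat.card G : ℝ) = Fintype.card F := by
      rw [hG]
      have : Nat.card (⊤ : Subfield F) = Nat.card F := Nat.card_congr Subfield.topEquiv.toEquiv
      rw [this, Nat.card_eq_fintype_card]
    rw [this] at hGc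
    have i1 : cE2 * K ^ 103 * N ≤ (c * K) ^ 103 * N := by
      rw [mul_pow]
      have : cE2 ≤ c ^ 103 := hc4.trans (le_self_pow₀ hc1 (by norm_num))
      gcongr
    linarith
  · have hY2 : (Y.card : ℝ) ≤ C * max ((Nat.card G : ℝ) ^ ((1:ℝ)/2))
        (N ^ ((31:ℝ)/191) * M ^ ((129:ℝ)/191)) := by
      refine le_trans ?_ (hsub G hG d a)
      rw [Nat.cast_le]
      apply Finset.card_le_card_of_injOn (fun y => a + d * y)
      · intro y hy
        have hy := Finset.mem_coe.1 hy
        exact Finset.mem_coe.2 ((@Finset.mem_filter _ _ (_) _ _).2 ⟨hYA y hy, y, hYG y hy, add_comm _ _⟩)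
      · intro y _ y' _ h
        exact mul_left_cancel₀ hd (add_left_cancel h)
    have hY0 : 0 < M / (cD * K ^ 18) := by positivity
    rcases le_total ((Nat.card G : ℝ) ^ ((1:ℝ)/2))
      (N ^ ((31:ℝ)/191) * M ^ ((129:ℝ)/191)) with h | h
    · rw [max_eq_right h] at hY2
      have j1 : (c * K) ^ 31 * (M / (cD * K ^ 18)) ≤ C * M := by
        calc (c * K) ^ 31 * (M / (cD * K ^ 18))
            ≤ (c * K) ^ 31 * (C * (N ^ ((31:ℝ)/191) * M ^ ((129:ℝ)/191))) := by
              gcongr; exact hYl.trans hY2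
          _ = C * ((c * K) ^ 31 * (N ^ ((31:ℝ)/191) * M ^ ((129:ℝ)/191))) := by ring
          _ ≤ C * M := by gcongr
      have j2 : (c * K) ^ 31 * (M / (cD * K ^ 18)) = (c ^ 31 * K ^ 13 / cD) * M := by
        field_simp
      rw [j2] at j1
      have j3 := le_of_mul_le_mul_right j1 hM0
      rw [div_le_iff₀ hcD] at j3
      have j4 : c ≤ c ^ 31 := le_self_pow₀ hc1 (by norm_num)
      have j5 : 1 ≤ K ^ 13 := one_le_pow₀ hK1
      have j6 : c ≤ c ^ 31 * K ^ 13 := by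
        calc c = c * 1 := by ring
          _ ≤ c ^ 31 * K ^ 13 := by gcongr
      linarith
    · rw [max_eq_left h, ← Real.sqrt_eq_rpow] at hY2
      have j1 := pow_le_pow_left₀ hY0.le (hYl.trans hY2) 2
      rw [mul_pow, Real.sq_sqrt (by positivity)] at j1
      have j2 : (c / cD ^ 2) * K ^ 155 * N ≤ C ^ 2 * (cE2 * K ^ 103 * N) := by
        refine (hMsq.trans j1).trans ?_
        gcongr
      have j3 : C ^ 2 * cE2 < c / cD ^ 2 := by rw [lt_div_iff₀ (by positivity)]; exact hc5
      have j4 : K ^ 103 ≤ K ^ 155 := pow_le_pow_right₀ hK1 (by norm_num)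
      have j5 : C ^ 2 * (cE2 * K ^ 103 * N) < (c / cD ^ 2) * K ^ 155 * N := by
        calc C ^ 2 * (cE2 * K ^ 103 * N) = C ^ 2 * cE2 * K ^ 103 * N := by ring
          _ ≤ C ^ 2 * cE2 * K ^ 155 * N := by gcongr
          _ < _ := by gcongr
      linarith


theorem stmt0 : ∀ C : ℝ, 0 < C → ∃ C' : ℝ, 0 < C' ∧
    ∀ (F : Type) [Field F] [Fintype F] (q : ℕ), IsPrimePow q → Fintype.card F = q →
    ∀ A B : Finset F, 2 ≤ B.card → B.card ≤ A.card →
    subfieldCond A C ((A.card : ℝ) ^ ((31:ℝ)/191) * (B.card : ℝ) ^ ((129:ℝ)/191)) →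
    (collinearTriples A B : ℝ) ≤
      C' * ((A.card : ℝ) ^ ((383:ℝ)/191) * (B.card : ℝ) ^ ((571:ℝ)/191)
        + (q : ℝ) ^ (-(1:ℝ)/103) * (A.card : ℝ) ^ ((207:ℝ)/103) * (B.card : ℝ) ^ (3:ℕ)
        + (A.card : ℝ) ^ (3:ℕ) * (B.card : ℝ)) := by
  intro C hC
  have hcD : 0 < cD := by unfold cD; positivity
  have hcM : 0 < cM := by unfold cM; positivity
  have hcE1 : 0 < cE1 := by unfold cE1; positivity
  have hcE2 : 0 < cE2 := by unfold cE2; positivity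
  have p1 : 0 < cE1 * cD ^ 2 := by positivity
  have p2 : 0 < C ^ 2 * cE2 * cD ^ 2 := by positivity
  have p3 : 0 < C * cD := by positivity
  obtain ⟨c, hc⟩ : ∃ c : ℝ, c = 1 + 2 * (2592 ^ 2 * 3072) + cE1 * cD ^ 2 + cE2 +
    C ^ 2 * cE2 * cD ^ 2 + C * cD := ⟨_, rfl⟩
  have hc1 : 1 ≤ c := by linarith
  have hc0 : 0 < c := by linarith
  refine ⟨8 * c, by positivity, ?_⟩
  intro F _ _ q _ hq A B hB hBA hsub
  by_contra hcon
  rw [not_le] at hcon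
  have n1 : 0 ≤ (A.card : ℝ) ^ ((383:ℝ)/191) * (B.card : ℝ) ^ ((571:ℝ)/191) := by positivity
  have n2 : 0 ≤ (q : ℝ) ^ (-(1:ℝ)/103) * (A.card : ℝ) ^ ((207:ℝ)/103) * (B.card : ℝ) ^ (3:ℕ) := by
    positivity
  have n3 : 0 ≤ (A.card : ℝ) ^ (3:ℕ) * (B.card : ℝ) := by positivity
  have m1 := mul_nonneg hc0.le n1
  have m2 := mul_nonneg hc0.le n2
  have m3 := mul_nonneg hc0.le n3
  refine finish C c hC hc1 (by linarith) (by linarith) (by linarith) (by linarith) (by linarith)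
    A B hB hBA hsub ?_ ?_ ?_
  · linarith
  · rw [hq]; linarith
  · have m4 : 1 * ((A.card : ℝ) ^ (3:ℕ) * (B.card : ℝ)) ≤
        c * ((A.card : ℝ) ^ (3:ℕ) * (B.card : ℝ)) := mul_le_mul_of_nonneg_right hc1 n3
    linarith

end STP
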